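/- arXiv:2210.11812 — 2 statements merged into one kernel-verified Lean document; each statement's English description precedes it below -/
import Mathlib

section
/- Let d ≥ 1 and let h : 𝕋^d×ℝ^d → ℝ be bounded and continuous. Then for every δ > 0, ℙ_{ε,μ_ε}( |π(h) − ∫_{𝕋^d×ℝ^d} h(x,v) M(v) dx dv| > δ ) → 0 along any family (μ_ε)_{ε>0} with μ_ε → ∞ and μ_ε ε^d → 0 as ε → 0. -/
open scoped Classical

open MeasureTheory Real Filter Topology

noncomputable section

abbrev Torus (d : ℕ) := Fin d → UnitAddCircle

abbrev Rd (d : ℕ) := EuclideanSpace ℝ (Fin d)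

/-- The Maxwellian density on `ℝ^d`. -/
def Maxw (d : ℕ) (v : Rd d) : ℝ := (2 * π) ^ (-(d : ℝ) / 2) * Real.exp (-‖v‖ ^ 2 / 2)

/-- The hard-sphere exclusion set `𝒟^ε_N`. -/
def excl (d : ℕ) (ε : ℝ) (N : ℕ) : Set (Fin N → Torus d) :=
  {X | ∀ i j, i ≠ j → ε < dist (X i) (X j)}

/-- `I_N(ε) = ∫_{(𝕋^d)^N} ∏_{i<j} 1_{dist > ε}`. -/
def exclInt (d : ℕ) (ε : ℝ) (N : ℕ) : ℝ := (volume (excl d ε N)).toReal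

/-- The grand canonical partition function `𝒵(μ, ε)`. -/
def partFun (d : ℕ) (ε μ : ℝ) : ℝ := ∑' N : ℕ, μ ^ N / N.factorial * exclInt d ε N

/-- The grand canonical phase space `⊔_N (𝕋^d × ℝ^d)^N`. -/
abbrev Phase (d : ℕ) := Σ N : ℕ, (Fin N → Torus d × Rd d)

/-- Density of the `N`-particle sector with respect to Lebesgue measure. -/
def sectorDens (d : ℕ) (ε μ : ℝ) (N : ℕ) (Z : Fin N → Torus d × Rd d) : ℝ :=
  (μ ^ N / N.factorial) * (if (fun i => (Z i).1) ∈ excl d ε N then 1 else 0)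
    * ∏ i, Maxw d (Z i).2

/-- The grand canonical hard-sphere equilibrium measure `ℙ_{ε,μ}`. -/
def gcMeasure (d : ℕ) (ε μ : ℝ) : Measure (Phase d) :=
  (ENNReal.ofReal (partFun d ε μ))⁻¹ •
    Measure.sum fun N =>
      Measure.map (Sigma.mk N)
        (volume.withDensity fun Z => ENNReal.ofReal (sectorDens d ε μ N Z))

/-- The empirical measure `π(h) = μ⁻¹ Σ_i h(z_i)`. -/
def empir (d : ℕ) (μ : ℝ) (h : Torus d × Rd d → ℝ) (ω : Phase d) : ℝ :=
  μ⁻¹ * ∑ i, h (ω.2 i)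

/-- The fluctuation field `ζ(h) = √μ (π(h) - 𝔼[π(h)])`. -/
def fluct (d : ℕ) (ε μ : ℝ) (h : Torus d × Rd d → ℝ) (ω : Phase d) : ℝ :=
  Real.sqrt μ * (empir d μ h ω - ∫ ω', empir d μ h ω' ∂(gcMeasure d ε μ))

end

noncomputable section

instance isProbabilityMeasure_unitAddCircle :
    IsProbabilityMeasure (volume : Measure UnitAddCircle) :=
  ⟨UnitAddCircle.measure_univ⟩

instance sigmaFinite_onePhase (d : ℕ) : SigmaFinite (volume : Measure (Torus d × Rd d)) :=
  inferInstance

lemma Maxw_pos (d : ℕ) (v : Rd d) : 0 < Maxw d v := by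
  unfold Maxw; positivity

lemma integral_Maxw (d : ℕ) : ∫ v, Maxw d v = 1 := by
  have h := GaussianFourier.integral_rexp_neg_mul_sq_norm (V := Rd d) (b := 1 / 2) (by norm_num)
  rw [finrank_euclideanSpace_fin] at h
  have e : (fun v : Rd d => Maxw d v)
      = fun v => (2 * π) ^ (-(d : ℝ) / 2) * Real.exp (-(1 / 2) * ‖v‖ ^ 2) := by
    funext v
    unfold Maxw
    congr 2
    ring
  rw [e, integral_const_mul, h, show π / (1 / 2) = 2 * π by ring,
    ← Real.rpow_add (by positivity)]
  simp [neg_div]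

lemma integrable_Maxw (d : ℕ) : Integrable (Maxw d) := by
  by_contra h
  have := integral_undef h
  rw [integral_Maxw] at this
  exact one_ne_zero this

lemma integrable_Maxw_snd (d : ℕ) : Integrable (fun z : Torus d × Rd d => Maxw d z.2) :=
  (integrable_Maxw d).comp_snd (volume : Measure (Torus d))

lemma integral_Maxw_snd (d : ℕ) : ∫ z : Torus d × Rd d, Maxw d z.2 = 1 := by
  rw [Measure.volume_eq_prod, integral_fun_snd, integral_Maxw]
  simp

lemma integrable_mul_Maxw {d : ℕ} {g : Torus d × Rd d → ℝ} (hg : Continuous g) {C : ℝ}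
    (hC : ∀ z, |g z| ≤ C) : Integrable (fun z => g z * Maxw d z.2) :=
  (integrable_Maxw_snd d).bdd_mul hg.aestronglyMeasurable (.of_forall hC)

lemma integrable_exp_mul_Maxw {d : ℕ} {h : Torus d × Rd d → ℝ} (hcont : Continuous h) {θ : ℝ}
    (hθ : ∀ z, |θ * h z| ≤ 1) : Integrable (fun z => Real.exp (θ * h z) * Maxw d z.2) := by
  refine integrable_mul_Maxw (by fun_prop) (C := Real.exp 1) fun z => ?_
  rw [abs_of_pos (Real.exp_pos _)]
  exact Real.exp_le_exp.2 (le_of_abs_le (hθ z))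

lemma integral_exp_mul_Maxw_le {d : ℕ} {h : Torus d × Rd d → ℝ} (hcont : Continuous h)
    {B θ : ℝ} (hB : ∀ z, |h z| ≤ B) (hθ : ∀ z, |θ * h z| ≤ 1) :
    ∫ z, Real.exp (θ * h z) * Maxw d z.2
      ≤ 1 + θ * (∫ z, h z * Maxw d z.2) + θ ^ 2 * B ^ 2 := by
  have hM := integrable_Maxw_snd d
  have hh := integrable_mul_Maxw hcont hB
  calc ∫ z, Real.exp (θ * h z) * Maxw d z.2
      ≤ ∫ z : Torus d × Rd d,
          ((1 + θ ^ 2 * B ^ 2) * Maxw d z.2 + θ * (h z * Maxw d z.2)) := by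
        refine integral_mono (integrable_exp_mul_Maxw hcont hθ)
          ((hM.const_mul _).add (hh.const_mul _)) fun z => ?_
        have h1 := le_of_abs_le (Real.abs_exp_sub_one_sub_id_le (hθ z))
        have h2 : h z ^ 2 ≤ B ^ 2 := sq_le_sq' (abs_le.1 (hB z)).1 (abs_le.1 (hB z)).2
        have h3 : θ ^ 2 * h z ^ 2 ≤ θ ^ 2 * B ^ 2 := by gcongr
        have h4 := Maxw_pos d z.2
        have : Real.exp (θ * h z) ≤ 1 + θ ^ 2 * B ^ 2 + θ * h z := by nlinarith
        calc _ ≤ (1 + θ ^ 2 * B ^ 2 + θ * h z) * Maxw d z.2 := by gcongr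
          _ = _ := by ring
    _ = _ := by
        rw [integral_add (hM.const_mul _) (hh.const_mul _), integral_const_mul,
          integral_const_mul, integral_Maxw_snd]
        ring

lemma isOpen_excl (d : ℕ) (ε : ℝ) (N : ℕ) : IsOpen (excl d ε N) := by
  have : excl d ε N = ⋂ i, ⋂ j, ⋂ _ : i ≠ j, {X | ε < dist (X i) (X j)} := by
    ext; simp [excl]
  rw [this]
  refine isOpen_iInter_of_finite fun i => isOpen_iInter_of_finite fun j =>
    isOpen_iInter_of_finite fun _ => isOpen_lt continuous_const (by fun_prop)

lemma volume_torus_closedBall_le (d : ℕ) {ε : ℝ} (hε : 0 ≤ ε) (x : Torus d) :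
    volume (Metric.closedBall x ε) ≤ ENNReal.ofReal ((2 * ε) ^ d) := by
  rw [MeasureTheory.volume_pi_closedBall _ hε]
  calc ∏ i, volume (Metric.closedBall (x i) ε) ≤ ∏ _i : Fin d, ENNReal.ofReal (2 * ε) := by
        gcongr with i
        rw [AddCircle.volume_closedBall]
        exact ENNReal.ofReal_le_ofReal (min_le_right _ _)
    _ = _ := by simp [ENNReal.ofReal_pow (by positivity : 0 ≤ 2 * ε)]

lemma one_sub_le_volume_avoiding (d : ℕ) {ε : ℝ} (hε : 0 ≤ ε) {N : ℕ} (Y : Fin N → Torus d) :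
    1 - N * ENNReal.ofReal ((2 * ε) ^ d) ≤ volume {x : Torus d | ∀ j, ε < dist x (Y j)} := by
  have e : {x : Torus d | ∀ j, ε < dist x (Y j)} = (⋃ j, Metric.closedBall (Y j) ε)ᶜ := by
    ext; simp
  rw [e, prob_compl_eq_one_sub (.iUnion fun j => Metric.isClosed_closedBall.measurableSet)]
  refine tsub_le_tsub_left ?_ _
  calc volume (⋃ j, Metric.closedBall (Y j) ε)
      ≤ ∑ j, volume (Metric.closedBall (Y j) ε) := measure_iUnion_fintype_le _ _
    _ ≤ ∑ _j : Fin N, ENNReal.ofReal ((2 * ε) ^ d) := by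
        gcongr with j; exact volume_torus_closedBall_le d hε _
    _ = _ := by simp

lemma volume_excl_succ_ge (d : ℕ) {ε : ℝ} (hε : 0 ≤ ε) (N : ℕ) :
    volume (excl d ε N) * (1 - N * ENNReal.ofReal ((2 * ε) ^ d))
      ≤ volume (excl d ε (N + 1)) := by
  let e := MeasurableEquiv.piFinSuccAbove (fun _ : Fin (N + 1) => Torus d) 0
  let B : Set (Torus d × (Fin N → Torus d)) :=
    {p | p.2 ∈ excl d ε N ∧ ∀ j, ε < dist p.1 (p.2 j)}
  have hBo : IsOpen B := by
    have : B = (Prod.snd ⁻¹' excl d ε N) ∩ ⋂ j, {p | ε < dist p.1 (p.2 j)} := by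
      ext; simp [B]
    rw [this]
    exact ((isOpen_excl d ε N).preimage continuous_snd).inter
      (isOpen_iInter_of_finite fun j => isOpen_lt continuous_const (by fun_prop))
  have hpre : e ⁻¹' B = excl d ε (N + 1) := by
    ext X
    simp only [Set.mem_preimage, B, Set.mem_ofPred_eq, excl, e,
      MeasurableEquiv.piFinSuccAbove_apply, Fin.insertNthEquiv_zero, Fin.consEquiv_symm_apply]
    constructor
    · rintro ⟨h1, h2⟩ i j hij
      induction i using Fin.cases with
      | zero =>
        induction j using Fin.cases with
        | zero => exact absurd rfl hij
        | succ j => exact h2 j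
      | succ i =>
        induction j using Fin.cases with
        | zero => rw [dist_comm]; exact h2 i
        | succ j => exact h1 i j fun h => hij (by rw [h])
    · intro h
      exact ⟨fun i j hij => h _ _ fun h' => hij (Fin.succ_injective _ h'),
        fun j => h _ _ (Fin.succ_ne_zero j).symm⟩
  have hmp := volume_preserving_piFinSuccAbove (fun _ : Fin (N + 1) => Torus d) 0
  rw [← hpre, hmp.measure_preimage hBo.measurableSet.nullMeasurableSet, Measure.volume_eq_prod,
    Measure.prod_apply_symm hBo.measurableSet, mul_comm, ← setLIntegral_const,
    ← lintegral_indicator (isOpen_excl d ε N).measurableSet]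
  refine lintegral_mono fun Y => ?_
  by_cases hY : Y ∈ excl d ε N
  · rw [Set.indicator_of_mem hY]
    refine (one_sub_le_volume_avoiding d hε Y).trans (measure_mono fun x hx => ?_)
    exact ⟨hY, hx⟩
  · rw [Set.indicator_of_notMem hY]
    exact zero_le

lemma exclInt_nonneg (d : ℕ) (ε : ℝ) (N : ℕ) : 0 ≤ exclInt d ε N := ENNReal.toReal_nonneg

lemma exclInt_le_one (d : ℕ) (ε : ℝ) (N : ℕ) : exclInt d ε N ≤ 1 := by
  have : volume (excl d ε N) ≤ 1 := prob_le_one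
  exact ENNReal.toReal_le_of_le_ofReal zero_le_one (by simpa)

lemma exclInt_succ_ge (d : ℕ) {ε : ℝ} (hε : 0 ≤ ε) (N : ℕ) :
    exclInt d ε N * (1 - N * (2 * ε) ^ d) ≤ exclInt d ε (N + 1) := by
  have h := ENNReal.toReal_mono (measure_ne_top _ _) (volume_excl_succ_ge d hε N)
  rw [ENNReal.toReal_mul] at h
  refine le_trans (mul_le_mul_of_nonneg_left ?_ (exclInt_nonneg d ε N)) h
  have h' := ENNReal.le_toReal_sub (a := 1) (b := N * ENNReal.ofReal ((2 * ε) ^ d))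
    (ENNReal.mul_ne_top (by simp) (by simp))
  rwa [ENNReal.toReal_mul, ENNReal.toReal_ofReal (by positivity), ENNReal.toReal_one,
    ENNReal.toReal_natCast] at h'

lemma descFactorial_div_pow_le_exclInt (d : ℕ) {ε : ℝ} (hε : 0 ≤ ε) {m : ℕ} (hm : 0 < m)
    (hmε : m * (2 * ε) ^ d ≤ 1) (N : ℕ) :
    (m.descFactorial N : ℝ) / m ^ N ≤ exclInt d ε N := by
  have hm' : (0 : ℝ) < m := by exact_mod_cast hm
  induction N with
  | zero =>
    have : excl d ε 0 = Set.univ := by ext; simp [excl]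
    simp [exclInt, this]
  | succ N ih =>
    rcases lt_or_ge m N with hN | hN
    · rw [Nat.descFactorial_eq_zero_iff_lt.2 (by lia)]
      simpa using exclInt_nonneg d ε (N + 1)
    · refine le_trans ?_ (exclInt_succ_ge d hε N)
      have h1 : (1 - N / m : ℝ) ≤ 1 - N * (2 * ε) ^ d := by
        have : (2 * ε) ^ d ≤ 1 / m := by rw [le_div_iff₀ hm']; linarith
        have := mul_le_mul_of_nonneg_left this (Nat.cast_nonneg (α := ℝ) N)
        rw [mul_one_div] at this
        linarith
      have h2 : (0 : ℝ) ≤ 1 - N / m := by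
        rw [sub_nonneg, div_le_one hm']; exact_mod_cast hN
      calc (m.descFactorial (N + 1) : ℝ) / m ^ (N + 1)
          = m.descFactorial N / m ^ N * (1 - N / m) := by
            rw [Nat.descFactorial_succ, Nat.cast_mul, Nat.cast_sub hN]
            field_simp
            ring
        _ ≤ _ := mul_le_mul ih h1 h2 (exclInt_nonneg d ε N)

lemma exp_le_partFun (d : ℕ) {ε μ : ℝ} (hε : 0 ≤ ε) (hμ : 0 ≤ μ) {m : ℕ} (hm : 0 < m)
    (hmε : m * (2 * ε) ^ d ≤ 1) : Real.exp (μ - μ * (μ / m)) ≤ partFun d ε μ := by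
  have hm' : (0 : ℝ) < m := by exact_mod_cast hm
  have hnn : ∀ N : ℕ, 0 ≤ μ ^ N / N.factorial * exclInt d ε N := fun N =>
    mul_nonneg (by positivity) (exclInt_nonneg d ε N)
  have hs : Summable fun N : ℕ => μ ^ N / N.factorial * exclInt d ε N :=
    (Real.summable_pow_div_factorial μ).of_nonneg_of_le hnn fun N =>
      mul_le_of_le_one_right (by positivity) (exclInt_le_one d ε N)
  set t : ℝ := μ / m with ht
  have ht0 : 0 ≤ t := by positivity
  have hμt : μ = m * t := by rw [ht]; field_simp
  have hexp : Real.exp (t - t ^ 2) ≤ 1 + t := by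
    have h1 : 1 - (t - t ^ 2) ≤ Real.exp (-(t - t ^ 2)) := by
      linarith [Real.add_one_le_exp (-(t - t ^ 2))]
    have h2 : 0 < 1 - (t - t ^ 2) := by nlinarith [sq_nonneg (t - 1 / 2)]
    calc Real.exp (t - t ^ 2) = (Real.exp (-(t - t ^ 2)))⁻¹ := by rw [Real.exp_neg, inv_inv]
      _ ≤ (1 - (t - t ^ 2))⁻¹ := inv_anti₀ h2 h1
      _ ≤ 1 + t := by
        rw [inv_le_iff_one_le_mul₀ h2]
        nlinarith [pow_nonneg ht0 3]
  calc Real.exp (μ - μ * t) = Real.exp (t - t ^ 2) ^ m := by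
        rw [← Real.exp_nat_mul, hμt]; congr 1; ring
    _ ≤ (t + 1) ^ m := by rw [add_comm]; gcongr
    _ = ∑ N ∈ Finset.range (m + 1), μ ^ N / N.factorial * (m.descFactorial N / m ^ N) := by
        rw [add_pow]
        refine Finset.sum_congr rfl fun N _ => ?_
        rw [Nat.descFactorial_eq_factorial_mul_choose, ht]
        push_cast
        rw [div_pow, one_pow]
        field_simp
    _ ≤ ∑ N ∈ Finset.range (m + 1), μ ^ N / N.factorial * exclInt d ε N := by
        gcongr with N
        exact descFactorial_div_pow_le_exclInt d hε hm hmε N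
    _ ≤ partFun d ε μ := hs.sum_le_tsum _ fun N _ => hnn N

lemma measurable_sigma_mk {ι : Type*} {β : ι → Type*} [m : ∀ i, MeasurableSpace (β i)] (i : ι) :
    Measurable (Sigma.mk i : β i → Σ i, β i) :=
  measurable_iff_le_map.2 (iInf_le (fun j => (m j).map (Sigma.mk j)) i)

lemma measurable_empir (d : ℕ) (μ : ℝ) {h : Torus d × Rd d → ℝ} (hh : Measurable h) :
    Measurable (empir d μ h) := by
  refine measurable_iff_le_map.2 ?_
  intro s hs
  refine MeasurableSpace.measurableSet_iInf.2 fun N => ?_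
  have : Measurable fun Z : Fin N → Torus d × Rd d => μ⁻¹ * ∑ i, h (Z i) := by fun_prop
  exact this hs

lemma lintegral_ofReal_const_mul_prod {α : Type*} [MeasureSpace α]
    [SigmaFinite (volume : Measure α)] {f : α → ℝ} (hf : Integrable f) (hf0 : ∀ z, 0 ≤ f z)
    {K : ℝ} (hK : 0 ≤ K) (N : ℕ) :
    ∫⁻ Z : Fin N → α, ENNReal.ofReal (K * ∏ i, f (Z i)) = ENNReal.ofReal (K * (∫ z, f z) ^ N) := by
  have hpi : Integrable fun Z : Fin N → α => ∏ i, f (Z i) := Integrable.fintype_prod fun _ => hf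
  rw [← ofReal_integral_eq_lintegral_ofReal (hpi.const_mul K)
    (.of_forall fun Z => mul_nonneg hK (Finset.prod_nonneg fun i _ => hf0 _)),
    integral_const_mul, integral_fintype_prod_volume_eq_pow, Fintype.card_fin]

/-- Exponential Markov bound for the unnormalised weight of a deviation in the `N`-particle
sector. -/
lemma sector_deviation_le (d : ℕ) {h : Torus d × Rd d → ℝ} (hcont : Continuous h)
    {ε μ θ : ℝ} (hμ : 0 < μ) (hθ0 : 0 ≤ θ) (hθ : ∀ z, |θ * h z| ≤ 1) (c : ℝ) (N : ℕ) :
    (volume.withDensity fun Z => ENNReal.ofReal (sectorDens d ε μ N Z))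
        {Z | c < empir d μ h ⟨N, Z⟩}
      ≤ ENNReal.ofReal (Real.exp (-(θ * μ * c)) *
          ((μ * ∫ z, Real.exp (θ * h z) * Maxw d z.2) ^ N / N.factorial)) := by
  set f : Torus d × Rd d → ℝ := fun z => Real.exp (θ * h z) * Maxw d z.2 with hf
  have hfi : Integrable f := integrable_exp_mul_Maxw hcont hθ
  have hfnn : ∀ z, 0 ≤ f z := fun z => mul_nonneg (Real.exp_pos _).le (Maxw_pos d _).le
  have hS : MeasurableSet {Z : Fin N → Torus d × Rd d | c < empir d μ h ⟨N, Z⟩} := by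
    have hm := hcont.measurable
    have : Measurable fun Z : Fin N → Torus d × Rd d => μ⁻¹ * ∑ i, h (Z i) := by fun_prop
    exact measurableSet_lt measurable_const this
  set K : ℝ := Real.exp (-(θ * μ * c)) * (μ ^ N / N.factorial) with hK
  have hK0 : 0 ≤ K := by positivity
  have hle : ∀ Z ∈ {Z : Fin N → Torus d × Rd d | c < empir d μ h ⟨N, Z⟩},
      ENNReal.ofReal (sectorDens d ε μ N Z) ≤ ENNReal.ofReal (K * ∏ i, f (Z i)) := by
    intro Z hZ
    refine ENNReal.ofReal_le_ofReal ?_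
    have hZ' : μ * c ≤ ∑ i, h (Z i) := by
      have hZ1 : c < μ⁻¹ * ∑ i, h (Z i) := hZ
      rw [inv_mul_eq_div, lt_div_iff₀ hμ] at hZ1
      linarith
    have hM0 : 0 ≤ ∏ i, Maxw d (Z i).2 := Finset.prod_nonneg fun i _ => (Maxw_pos d _).le
    calc sectorDens d ε μ N Z
        ≤ μ ^ N / N.factorial * 1 * ∏ i, Maxw d (Z i).2 := by
          unfold sectorDens
          gcongr
          split_ifs <;> simp
      _ ≤ μ ^ N / N.factorial * Real.exp (θ * (∑ i, h (Z i)) - θ * μ * c)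
            * ∏ i, Maxw d (Z i).2 := by
          gcongr
          refine Real.one_le_exp ?_
          nlinarith
      _ = K * ∏ i, f (Z i) := by
          rw [hK, hf, Finset.prod_mul_distrib, ← Real.exp_sum, ← Finset.mul_sum,
            sub_eq_add_neg, Real.exp_add]
          ring
  have hprod := lintegral_ofReal_const_mul_prod hfi hfnn hK0 N
  rw [withDensity_apply _ hS]
  refine (setLIntegral_mono' hS hle).trans ((setLIntegral_le_lintegral _ _).trans ?_)
  rw [hprod, hK, mul_pow]
  refine le_of_eq (congrArg ENNReal.ofReal ?_)
  ring

lemma gcMeasure_deviation_le (d : ℕ) {h : Torus d × Rd d → ℝ} (hcont : Continuous h)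
    {B ε μ θ δ : ℝ} (hB : ∀ z, |h z| ≤ B) (hε : 0 ≤ ε) (hμ : 0 < μ) (hθ0 : 0 ≤ θ)
    (hθ : ∀ z, |θ * h z| ≤ 1) {m : ℕ} (hm : 0 < m) (hmε : m * (2 * ε) ^ d ≤ 1) :
    gcMeasure d ε μ {ω | δ < empir d μ h ω - ∫ z, h z * Maxw d z.2}
      ≤ ENNReal.ofReal (Real.exp (μ * (θ ^ 2 * B ^ 2 - θ * δ + μ / m))) := by
  set I : ℝ := ∫ z, h z * Maxw d z.2 with hI
  set a : ℝ := ∫ z, Real.exp (θ * h z) * Maxw d z.2 with ha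
  have ha0 : 0 ≤ a := integral_nonneg fun z => mul_nonneg (Real.exp_pos _).le (Maxw_pos d _).le
  have haI : a ≤ 1 + θ * I + θ ^ 2 * B ^ 2 := integral_exp_mul_Maxw_le hcont hB hθ
  have hset : {ω : Phase d | δ < empir d μ h ω - I} = {ω | δ + I < empir d μ h ω} := by
    ext; simp [lt_sub_iff_add_lt]
  have hS : MeasurableSet {ω : Phase d | δ + I < empir d μ h ω} :=
    measurableSet_lt measurable_const (measurable_empir d μ hcont.measurable)
  have hsum : HasSum (fun N : ℕ => Real.exp (-(θ * μ * (δ + I))) * ((μ * a) ^ N / N.factorial))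
      (Real.exp (-(θ * μ * (δ + I))) * Real.exp (μ * a)) := by
    refine HasSum.mul_left _ ?_
    rw [Real.exp_eq_exp_ℝ]
    exact NormedSpace.expSeries_div_hasSum_exp _
  have hZ := exp_le_partFun d hε hμ.le hm hmε
  rw [hset, gcMeasure, Measure.smul_apply, Measure.sum_apply _ hS, smul_eq_mul]
  calc _ ≤ (ENNReal.ofReal (Real.exp (μ - μ * (μ / m))))⁻¹ *
        ∑' N : ℕ, ENNReal.ofReal
          (Real.exp (-(θ * μ * (δ + I))) * ((μ * a) ^ N / N.factorial)) := by
        gcongr with N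
        rw [Measure.map_apply (measurable_sigma_mk N) hS]
        exact sector_deviation_le d hcont hμ hθ0 hθ (δ + I) N
    _ = ENNReal.ofReal (Real.exp (-(μ - μ * (μ / m))) *
          (Real.exp (-(θ * μ * (δ + I))) * Real.exp (μ * a))) := by
        rw [← ENNReal.ofReal_tsum_of_nonneg (fun N => by positivity) hsum.summable,
          hsum.tsum_eq, ← ENNReal.ofReal_inv_of_pos (Real.exp_pos _), ← Real.exp_neg,
          ← ENNReal.ofReal_mul (Real.exp_pos _).le]
    _ ≤ _ := by
        rw [← Real.exp_add, ← Real.exp_add]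
        refine ENNReal.ofReal_le_ofReal (Real.exp_le_exp.2 ?_)
        nlinarith [mul_le_mul_of_nonneg_left haI hμ.le]

lemma gcMeasure_abs_deviation_le (d : ℕ) {h : Torus d × Rd d → ℝ} (hcont : Continuous h)
    {B ε μ θ δ : ℝ} (hB : ∀ z, |h z| ≤ B) (hε : 0 ≤ ε) (hμ : 0 < μ) (hθ0 : 0 ≤ θ)
    (hθ : ∀ z, |θ * h z| ≤ 1) {m : ℕ} (hm : 0 < m) (hmε : m * (2 * ε) ^ d ≤ 1) :
    gcMeasure d ε μ {ω | δ < |empir d μ h ω - ∫ z, h z * Maxw d z.2|}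
      ≤ 2 * ENNReal.ofReal (Real.exp (μ * (θ ^ 2 * B ^ 2 - θ * δ + μ / m))) := by
  have hneg : ∫ z, -h z * Maxw d z.2 = -∫ z, h z * Maxw d z.2 := by
    simp_rw [neg_mul]; exact integral_neg _
  have h1 := gcMeasure_deviation_le d hcont (δ := δ) hB hε hμ hθ0 hθ hm hmε
  have h2 := gcMeasure_deviation_le d (h := fun z => -h z) hcont.neg (δ := δ)
    (by simpa using hB) hε hμ hθ0 (by simpa using hθ) hm hmε
  rw [two_mul]
  refine le_trans ((measure_mono ?_).trans (measure_union_le _ _)) (add_le_add h1 h2)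
  intro ω hω
  have hω' : δ < |empir d μ h ω - ∫ z, h z * Maxw d z.2| := hω
  rcases lt_abs.1 hω' with hpos | hlt
  · exact Or.inl hpos
  · refine Or.inr ?_
    simp only [Set.mem_ofPred_eq, hneg]
    have : empir d μ (fun z => -h z) ω = -empir d μ h ω := by simp [empir]
    rw [this]
    linarith

/-- law of large numbers: for bounded continuous `h`, under the grand
canonical hard-sphere equilibrium measure, `ℙ_{ε,μ_ε}(|π(h) - ∫ h M| > δ) → 0`
along any family `μ_ε → ∞` with `μ_ε ε^d → 0`. -/
theorem empirical_LLN (d : ℕ) (hd : 1 ≤ d) (h : Torus d × Rd d → ℝ)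
    (hcont : Continuous h) (hbdd : ∃ B : ℝ, ∀ z, |h z| ≤ B)
    (δ : ℝ) (hδ : 0 < δ) (μ : ℝ → ℝ)
    (hμ : Tendsto μ (𝓝[>] (0 : ℝ)) atTop)
    (hμε : Tendsto (fun ε => μ ε * ε ^ d) (𝓝[>] (0 : ℝ)) (𝓝 0)) :
    Tendsto
      (fun ε => gcMeasure d ε (μ ε)
        {ω : Phase d |
          δ < |empir d (μ ε) h ω - ∫ z : Torus d × Rd d, h z * Maxw d z.2|})
      (𝓝[>] (0 : ℝ)) (𝓝 0) := by
  obtain ⟨B₀, hB₀⟩ := hbdd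
  obtain ⟨B, hB1, hB⟩ : ∃ B : ℝ, 1 ≤ B ∧ ∀ z, |h z| ≤ B :=
    ⟨max 1 B₀, le_max_left _ _, fun z => (hB₀ z).trans (le_max_right _ _)⟩
  have hB0 : 0 < B := by linarith
  obtain ⟨θ, hθ0, hθB, hθδ⟩ : ∃ θ : ℝ, 0 < θ ∧ θ * B ≤ 1 ∧ θ * B ^ 2 ≤ δ / 2 := by
    refine ⟨min (1 / B) (δ / 2 / B ^ 2), by positivity, ?_, ?_⟩
    · rw [← le_div_iff₀ hB0]; exact min_le_left _ _
    · rw [← le_div_iff₀ (by positivity)]; exact min_le_right _ _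
  have hθ : ∀ z, |θ * h z| ≤ 1 := fun z => by
    rw [abs_mul, abs_of_pos hθ0]
    exact (mul_le_mul_of_nonneg_left (hB z) hθ0.le).trans hθB
  have hvol : Tendsto (fun ε => μ ε * (2 * ε) ^ d) (𝓝[>] (0 : ℝ)) (𝓝 0) := by
    have := hμε.const_mul (2 ^ d)
    rw [mul_zero] at this
    refine this.congr fun ε => ?_
    rw [mul_pow]; ring
  have hlim : Tendsto (fun ε => 2 * ENNReal.ofReal (Real.exp (-(θ * δ / 4 * μ ε))))
      (𝓝[>] (0 : ℝ)) (𝓝 0) := by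
    have h1 : Tendsto (fun ε => Real.exp (-(θ * δ / 4 * μ ε))) (𝓝[>] (0 : ℝ)) (𝓝 0) :=
      Real.tendsto_exp_neg_atTop_nhds_zero.comp (hμ.const_mul_atTop (by positivity))
    have h2 := ENNReal.Tendsto.const_mul (a := 2) (ENNReal.tendsto_ofReal h1) (.inr (by simp))
    simpa using h2
  refine tendsto_of_tendsto_of_tendsto_of_le_of_le' tendsto_const_nhds hlim
    (.of_forall fun _ => zero_le) ?_
  filter_upwards [self_mem_nhdsWithin, hμ.eventually_ge_atTop 1,
    hvol.eventually_le_const (show (0 : ℝ) < 1 / 2 by norm_num),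
    hvol.eventually_le_const (show 0 < θ * δ / 8 by positivity)] with ε hε hμ1 hv1 hv2
  have hε0 : 0 < ε := hε
  set c : ℝ := (2 * ε) ^ d with hc
  have hc0 : 0 < c := by positivity
  have hc1 : c ≤ 1 / 2 := by nlinarith
  have hcinv : 2 ≤ c⁻¹ := by
    rw [le_inv_comm₀ two_pos hc0]; linarith
  set m : ℕ := ⌊c⁻¹⌋₊ with hm
  have hm_le : (m : ℝ) ≤ c⁻¹ := Nat.floor_le (by positivity)
  have hm_ge : c⁻¹ / 2 ≤ m := by
    have := Nat.lt_floor_add_one c⁻¹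
    linarith
  have hm0 : (0 : ℝ) < m := by linarith
  have hmc : m * c ≤ 1 := by
    calc m * c ≤ c⁻¹ * c := by gcongr
      _ = 1 := inv_mul_cancel₀ hc0.ne'
  have hμm : μ ε / m ≤ θ * δ / 4 := by
    calc μ ε / m ≤ μ ε / (c⁻¹ / 2) := by gcongr
      _ = 2 * (μ ε * c) := by field_simp
      _ ≤ θ * δ / 4 := by linarith
  refine (gcMeasure_abs_deviation_le d hcont hB hε0.le (by linarith) hθ0.le hθ
    (by exact_mod_cast hm0) hmc).trans ?_
  gcongr
  have : θ ^ 2 * B ^ 2 - θ * δ + μ ε / m ≤ -(θ * δ / 4) := by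
    nlinarith [mul_le_mul_of_nonneg_left hθδ hθ0.le]
  nlinarith [mul_le_mul_of_nonneg_left this (show 0 ≤ μ ε by linarith)]

end
end

section
/- Let d ≥ 1 and let h₁, h₂ : 𝕋^d×ℝ^d → ℝ be bounded Lipschitz functions. Then 𝔼_{ε,μ_ε}[ζ(h₁) ζ(h₂)] → ∫_{𝕋^d×ℝ^d} h₁(x,v) h₂(x,v) M(v) dx dv along any family (μ_ε)_{ε>0} with μ_ε → ∞ and μ_ε ε^d → 0 as ε → 0. -/
open scoped Classical

open MeasureTheory Real Filter Topology

noncomputable section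

namespace HardCore

variable {X : Type*} [MeasurableSpace X]

/-- Configurations of `N` points that are pairwise related by `C`. -/
def compatible (C : X → X → Prop) (N : ℕ) : Set (Fin N → X) :=
  {x | ∀ i j, i ≠ j → C (x i) (x j)}

/-- The unnormalised grand canonical measure of a hard-core gas with reference measure `m`,
compatibility relation `C` and activity `μ`. -/
def gas (m : Measure X) (C : X → X → Prop) (μ : ℝ) : Measure (Σ N : ℕ, (Fin N → X)) :=
  Measure.sum fun N =>
    (ENNReal.ofReal (μ ^ N / N.factorial) •
      (Measure.pi fun _ => m).restrict (compatible C N)).map (Sigma.mk N)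

/-- The partition function of the hard-core gas with inhomogeneous relative activity `f`. -/
def partition (m : Measure X) (C : X → X → Prop) (μ : ℝ) (f : X → ℝ) : ℝ :=
  ∫ ω, ∏ i, f (ω.2 i) ∂(gas m C μ)

/-- The activity `f` restricted to the points compatible with `x`. -/
def thin (C : X → X → Prop) (f : X → ℝ) (x y : X) : ℝ := if C x y then f y else 0

theorem measurable_sigmaMk {ι : Type*} {β : ι → Type*} [∀ i, MeasurableSpace (β i)] (i : ι) :
    Measurable (Sigma.mk i : β i → Σ i, β i) :=
  fun _ hs => (MeasurableSpace.measurableSet_iInf.1 hs) i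

theorem measurable_sigma {ι : Type*} {β : ι → Type*} [∀ i, MeasurableSpace (β i)]
    {γ : Type*} [MeasurableSpace γ] {F : (Σ i, β i) → γ}
    (hF : ∀ i, Measurable fun x => F ⟨i, x⟩) : Measurable F :=
  fun _ hs => MeasurableSpace.measurableSet_iInf.2 fun i => hF i hs

theorem measurable_thin {C : X → X → Prop} (hC : MeasurableSet {p : X × X | C p.1 p.2})
    {f : X → ℝ} (hf : Measurable f) : Measurable fun p : X × X => thin C f p.1 p.2 :=
  Measurable.ite hC (hf.comp measurable_snd) measurable_const

theorem measurable_thin_right {C : X → X → Prop} (hC : MeasurableSet {p : X × X | C p.1 p.2})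
    {f : X → ℝ} (hf : Measurable f) (x : X) : Measurable (thin C f x) :=
  (measurable_thin hC hf).comp (measurable_const.prodMk measurable_id)

omit [MeasurableSpace X] in
theorem abs_thin_le (C : X → X → Prop) {f : X → ℝ} {R : ℝ} (hf : ∀ x, |f x| ≤ R) (x y : X) :
    |thin C f x y| ≤ R := by
  unfold thin
  split_ifs
  · exact hf y
  · simpa using (abs_nonneg _).trans (hf y)

theorem measurableSet_compatible {C : X → X → Prop}
    (hC : MeasurableSet {p : X × X | C p.1 p.2}) (N : ℕ) : MeasurableSet (compatible C N) := by
  have : compatible C N = ⋂ i, ⋂ j, {x : Fin N → X | i ≠ j → C (x i) (x j)} := by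
    ext x; simp [compatible]
  rw [this]
  refine MeasurableSet.iInter fun i => MeasurableSet.iInter fun j => ?_
  by_cases h : i = j
  · simp [h]
  · simpa [h] using
      (show Measurable fun x : Fin N → X => (x i, x j) by fun_prop) hC

theorem abs_prod_le {ι : Type*} (s : Finset ι) {g : ι → ℝ} {R : ℝ} (hg : ∀ i, |g i| ≤ R) :
    |∏ i ∈ s, g i| ≤ R ^ s.card := by
  rw [Finset.abs_prod]
  exact (Finset.prod_le_prod (fun i _ => abs_nonneg _) fun i _ => hg i).trans
    (by rw [Finset.prod_const])

theorem prod_erase_eq_prod_succAbove {N : ℕ} (i : Fin (N + 1)) (g : Fin (N + 1) → ℝ) :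
    ∏ j ∈ Finset.univ.erase i, g j = ∏ k, g (i.succAbove k) := by
  have h1 : ∏ j ∈ Finset.univ.erase i, g j
      = ∏ j ∈ Finset.univ.erase i, if j = i then 1 else g j :=
    Finset.prod_congr rfl fun j hj => by simp [Finset.ne_of_mem_erase hj]
  rw [h1, Finset.prod_erase _ (by simp), Fin.prod_univ_succAbove _ i]
  simp [Fin.succAbove_ne]

section Integration

variable (m : Measure X) [IsProbabilityMeasure m] (C : X → X → Prop) {μ : ℝ}

theorem abs_setIntegral_pi_le {N : ℕ} {s : Set (Fin N → X)} {F : (Fin N → X) → ℝ} {K : ℝ}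
    (hK : 0 ≤ K) (hF : ∀ x, |F x| ≤ K) :
    |∫ x in s, F x ∂(Measure.pi fun _ => m)| ≤ K := by
  refine (norm_setIntegral_le_of_norm_le_const (C := K) (measure_lt_top _ _)
    fun x _ => (Real.norm_eq_abs _).trans_le (hF x)).trans ?_
  exact mul_le_of_le_one_right hK measureReal_le_one

theorem integrable_of_abs_le {Y : Type*} [MeasurableSpace Y] {ν : Measure Y} [IsFiniteMeasure ν]
    {F : Y → ℝ} (hF : Measurable F) {K : ℝ} (hb : ∀ y, |F y| ≤ K) : Integrable F ν :=
  Integrable.of_bound hF.aestronglyMeasurable K (Eventually.of_forall hb)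

omit [IsProbabilityMeasure m] in
theorem integral_sector (hμ : 0 ≤ μ) {F : (Σ N : ℕ, (Fin N → X)) → ℝ} (hF : Measurable F) (N : ℕ) :
    ∫ ω, F ω ∂((ENNReal.ofReal (μ ^ N / N.factorial) •
      (Measure.pi fun _ => m).restrict (compatible C N)).map (Sigma.mk N))
      = μ ^ N / N.factorial * ∫ x in compatible C N, F ⟨N, x⟩ ∂(Measure.pi fun _ => m) := by
  rw [integral_map (measurable_sigmaMk N).aemeasurable hF.aestronglyMeasurable,
    integral_smul_measure, ENNReal.toReal_ofReal (by positivity), smul_eq_mul]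

theorem integrable_gas (hμ : 0 ≤ μ) {F : (Σ N : ℕ, (Fin N → X)) → ℝ} (hF : Measurable F)
    {K R : ℝ} (hK : 0 ≤ K) (hR : 0 ≤ R) (hb : ∀ ω, |F ω| ≤ K * R ^ ω.1) :
    Integrable F (gas m C μ) := by
  refine integrable_sum_measure (fun N => ?_) ?_
  · refine (integrable_map_measure hF.aestronglyMeasurable (measurable_sigmaMk N).aemeasurable).2 ?_
    exact (integrable_of_abs_le (hF.comp (measurable_sigmaMk N)) (K := K * R ^ N)
      fun x => hb ⟨N, x⟩).smul_measure ENNReal.ofReal_ne_top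
  · have hs : Summable fun N : ℕ => K * ((μ * R) ^ N / N.factorial) :=
      (Real.summable_pow_div_factorial _).mul_left K
    refine hs.of_nonneg_of_le (fun N => integral_nonneg fun _ => norm_nonneg _) fun N => ?_
    rw [integral_sector m C hμ hF.norm N]
    have := (le_abs_self _).trans (abs_setIntegral_pi_le m (s := compatible C N)
      (F := fun x => ‖F ⟨N, x⟩‖) (K := K * R ^ N) (by positivity) fun x => by
        rw [abs_norm]; exact hb ⟨N, x⟩)
    calc _ ≤ μ ^ N / N.factorial * (K * R ^ N) := by gcongr
      _ = _ := by rw [mul_pow]; ring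

theorem hasSum_integral_gas (hμ : 0 ≤ μ) {F : (Σ N : ℕ, (Fin N → X)) → ℝ} (hF : Measurable F)
    {K R : ℝ} (hK : 0 ≤ K) (hR : 0 ≤ R) (hb : ∀ ω, |F ω| ≤ K * R ^ ω.1) :
    HasSum (fun N : ℕ => μ ^ N / N.factorial *
      ∫ x in compatible C N, F ⟨N, x⟩ ∂(Measure.pi fun _ => m)) (∫ ω, F ω ∂(gas m C μ)) := by
  have h := hasSum_integral_measure (integrable_gas m C hμ hF hK hR hb)
  simp only [integral_sector m C hμ hF] at h
  exact h

theorem measurable_prod_config {f : X → ℝ} (hf : Measurable f) :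
    Measurable fun ω : Σ N : ℕ, (Fin N → X) => ∏ i, f (ω.2 i) :=
  measurable_sigma fun N => Finset.measurable_prod (f := fun i (x : Fin N → X) => f (x i))
    Finset.univ fun i _ => by fun_prop

theorem hasSum_partition (hμ : 0 ≤ μ) {f : X → ℝ} (hf : Measurable f) {R : ℝ} (hR : 0 ≤ R)
    (hb : ∀ x, |f x| ≤ R) :
    HasSum (fun N : ℕ => μ ^ N / N.factorial *
      ∫ x in compatible C N, ∏ i, f (x i) ∂(Measure.pi fun _ => m)) (partition m C μ f) :=
  hasSum_integral_gas m C hμ (measurable_prod_config hf) zero_le_one hR fun ω => by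
    simpa using abs_prod_le Finset.univ fun i => hb (ω.2 i)

variable {C}

theorem measurable_sector_thin (hC : MeasurableSet {p : X × X | C p.1 p.2}) {f : X → ℝ}
    (hf : Measurable f) (N : ℕ) :
    Measurable fun x => ∫ y in compatible C N, ∏ j, thin C f x (y j) ∂(Measure.pi fun _ => m) := by
  refine (StronglyMeasurable.integral_prod_right (Measurable.stronglyMeasurable ?_)).measurable
  refine Finset.measurable_prod _ fun j _ => ?_
  exact (measurable_thin hC hf).comp
    (measurable_fst.prodMk ((measurable_pi_apply j).comp measurable_snd))

theorem measurable_partition_thin (hμ : 0 ≤ μ) (hC : MeasurableSet {p : X × X | C p.1 p.2})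
    {f : X → ℝ} (hf : Measurable f) {R : ℝ} (hR : 0 ≤ R) (hb : ∀ x, |f x| ≤ R) :
    Measurable fun x => partition m C μ (thin C f x) := by
  refine measurable_of_tendsto_metrizable (f := fun n x => ∑ N ∈ Finset.range n,
    μ ^ N / N.factorial *
      ∫ y in compatible C N, ∏ j, thin C f x (y j) ∂(Measure.pi fun _ => m)) (fun n => ?_) ?_
  · exact Finset.measurable_sum _ fun N _ => (measurable_sector_thin m hC hf N).const_mul _
  · exact tendsto_pi_nhds.2 fun x => (hasSum_partition m C hμ (measurable_thin_right hC hf x) hR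
      (abs_thin_le C hb x)).tendsto_sum_nat

theorem integral_sector_succ (hC : MeasurableSet {p : X × X | C p.1 p.2})
    (hsymm : ∀ x y, C x y → C y x) {a f : X → ℝ} (ha : Measurable a) (hf : Measurable f)
    {K R : ℝ} (hK : ∀ x, |a x| ≤ K) (hb : ∀ x, |f x| ≤ R) {N : ℕ} (i : Fin (N + 1)) :
    ∫ x in compatible C (N + 1), a (x i) * ∏ j ∈ Finset.univ.erase i, f (x j)
        ∂(Measure.pi fun _ => m)
      = ∫ x, a x * ∫ y in compatible C N, ∏ j, thin C f x (y j) ∂(Measure.pi fun _ => m) ∂m := by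
  set G : (Fin (N + 1) → X) → ℝ := (compatible C (N + 1)).indicator
    fun x => a (x i) * ∏ j ∈ Finset.univ.erase i, f (x j) with hG
  have hGm : Measurable G :=
    Measurable.indicator (by fun_prop) (measurableSet_compatible hC _)
  have hGb : ∀ x, |G x| ≤ K * R ^ (Finset.univ.erase i).card := fun x => by
    have hK0 := (abs_nonneg _).trans (hK (x i))
    have hR0 := (abs_nonneg _).trans (hb (x i))
    by_cases h : x ∈ compatible C (N + 1)
    · rw [hG, Set.indicator_of_mem h, abs_mul]
      exact mul_le_mul (hK _) (abs_prod_le _ fun j => hb _) (abs_nonneg _) hK0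
    · rw [hG, Set.indicator_of_notMem h, abs_zero]; positivity
  rw [← integral_indicator (measurableSet_compatible hC _), ← hG,
    ← (measurePreserving_piFinSuccAbove (fun _ => m) i).symm.integral_comp' G, integral_prod]
  · refine integral_congr_ae (Eventually.of_forall fun x => ?_)
    simp only
    rw [← integral_const_mul, ← integral_indicator (measurableSet_compatible hC _)]
    refine integral_congr_ae (Eventually.of_forall fun y => ?_)
    simp only
    have he : (MeasurableEquiv.piFinSuccAbove (fun _ : Fin (N + 1) => X) i).symm (x, y)
        = i.insertNth x y := rfl
    rw [he, hG]
    have hmem : i.insertNth (α := fun _ => X) x y ∈ compatible C (N + 1) ↔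
        y ∈ compatible C N ∧ ∀ j, C x (y j) := by
      simp only [compatible, Set.mem_ofPred_eq, Fin.forall_iff_succAbove i,
        Fin.insertNth_apply_same, Fin.insertNth_apply_succAbove]
      constructor
      · rintro ⟨⟨-, h1⟩, h2⟩
        exact ⟨fun j k hjk => (h2 j).2 k (by simpa using hjk),
          fun j => h1 j (Fin.succAbove_ne i j).symm⟩
      · rintro ⟨h1, h2⟩
        exact ⟨⟨fun h => absurd rfl h, fun j _ => h2 j⟩, fun j =>
          ⟨fun _ => hsymm _ _ (h2 j), fun k hjk => h1 j k (by simpa using hjk)⟩⟩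
    by_cases h1 : y ∈ compatible C N
    · by_cases h2 : ∀ j, C x (y j)
      · rw [Set.indicator_of_mem (hmem.2 ⟨h1, h2⟩), Set.indicator_of_mem h1,
          prod_erase_eq_prod_succAbove]
        simp [thin, h2]
      · rw [Set.indicator_of_notMem (fun h => h2 (hmem.1 h).2), Set.indicator_of_mem h1]
        push Not at h2
        obtain ⟨j, hj⟩ := h2
        rw [Finset.prod_eq_zero (Finset.mem_univ j) (by simp [thin, hj]), mul_zero]
    · rw [Set.indicator_of_notMem (fun h => h1 (hmem.1 h).1), Set.indicator_of_notMem h1]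
  · exact integrable_of_abs_le
      (hGm.comp (MeasurableEquiv.piFinSuccAbove (fun _ : Fin (N + 1) => X) i).symm.measurable)
      fun p => hGb _

theorem measurable_sum_mul_prod_erase {a f : X → ℝ} (ha : Measurable a) (hf : Measurable f) :
    Measurable fun ω : Σ N : ℕ, (Fin N → X) =>
      ∑ i, a (ω.2 i) * ∏ j ∈ Finset.univ.erase i, f (ω.2 j) :=
  measurable_sigma fun N =>
    Finset.measurable_sum
      (f := fun i (x : Fin N → X) => a (x i) * ∏ j ∈ Finset.univ.erase i, f (x j))
      Finset.univ fun i _ => by fun_prop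

theorem natCast_le_two_pow (N : ℕ) : (N : ℝ) ≤ 2 ^ N := by
  exact_mod_cast N.lt_two_pow_self.le

omit [MeasurableSpace X] in
theorem abs_sum_mul_prod_erase_le {a f : X → ℝ} {K R : ℝ} (hK0 : 0 ≤ K)
    (hK : ∀ x, |a x| ≤ K) (hR : 1 ≤ R) (hb : ∀ x, |f x| ≤ R) (ω : Σ N : ℕ, (Fin N → X)) :
    |∑ i, a (ω.2 i) * ∏ j ∈ Finset.univ.erase i, f (ω.2 j)| ≤ K * (2 * R) ^ ω.1 := by
  obtain ⟨N, x⟩ := ω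
  calc |∑ i, a (x i) * ∏ j ∈ Finset.univ.erase i, f (x j)|
      ≤ ∑ i, |a (x i) * ∏ j ∈ Finset.univ.erase i, f (x j)| := Finset.abs_sum_le_sum_abs _ _
    _ ≤ ∑ _i : Fin N, K * R ^ N := by
        refine Finset.sum_le_sum fun i _ => ?_
        rw [abs_mul]
        refine mul_le_mul (hK _) ((abs_prod_le _ fun j => hb _).trans ?_) (abs_nonneg _) hK0
        exact pow_le_pow_right₀ hR ((Finset.card_le_univ _).trans (by simp))
    _ = N * (K * R ^ N) := by simp
    _ ≤ 2 ^ N * (K * R ^ N) := by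
        gcongr; exact natCast_le_two_pow _
    _ = _ := by rw [mul_pow]; ring

/-- The Campbell–Mecke identity for the hard-core gas. -/
theorem integral_sum_mul_prod_erase (hμ : 0 ≤ μ) (hC : MeasurableSet {p : X × X | C p.1 p.2})
    (hsymm : ∀ x y, C x y → C y x) {a f : X → ℝ} (ha : Measurable a) (hf : Measurable f)
    {K R : ℝ} (hK0 : 0 ≤ K) (hK : ∀ x, |a x| ≤ K) (hR : 1 ≤ R) (hb : ∀ x, |f x| ≤ R) :
    ∫ ω, ∑ i, a (ω.2 i) * ∏ j ∈ Finset.univ.erase i, f (ω.2 j) ∂(gas m C μ)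
      = μ * ∫ x, a x * partition m C μ (thin C f x) ∂m := by
  have hR0 : 0 ≤ R := zero_le_one.trans hR
  have h1 := hasSum_integral_gas m C hμ (measurable_sum_mul_prod_erase ha hf) hK0
    (by positivity : (0 : ℝ) ≤ 2 * R) (abs_sum_mul_prod_erase_le hK0 hK hR hb)
  set T : ℕ → X → ℝ := fun N x =>
    ∫ y in compatible C N, ∏ j, thin C f x (y j) ∂(Measure.pi fun _ => m) with hT
  have hTm : ∀ N, Measurable (T N) := measurable_sector_thin m hC hf
  have hTb : ∀ N x, |T N x| ≤ R ^ N := fun N x =>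
    abs_setIntegral_pi_le m (by positivity) fun y => by
      simpa using abs_prod_le Finset.univ fun j => abs_thin_le C hb x (y j)
  have hs := Real.summable_pow_div_factorial (μ * R)
  have hbd : ∀ N x, ‖a x * (μ ^ N / N.factorial * T N x)‖ ≤ K * ((μ * R) ^ N / N.factorial) := by
    intro N x
    have hc : (0 : ℝ) ≤ μ ^ N / N.factorial := by positivity
    rw [Real.norm_eq_abs, abs_mul, abs_mul, abs_of_nonneg hc]
    calc |a x| * (μ ^ N / N.factorial * |T N x|) ≤ K * (μ ^ N / N.factorial * R ^ N) := by
          gcongr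
          · exact hK x
          · exact hTb N x
      _ = _ := by rw [mul_pow]; ring
  have h2 : HasSum (fun N => ∫ x, a x * (μ ^ N / N.factorial * T N x) ∂m)
      (∫ x, a x * partition m C μ (thin C f x) ∂m) := by
    refine hasSum_integral_of_dominated_convergence
      (fun N _ => K * ((μ * R) ^ N / N.factorial)) (fun N => ?_)
      (fun N => Eventually.of_forall (hbd N)) (Eventually.of_forall fun _ => hs.mul_left K)
      (integrable_const _) (Eventually.of_forall fun x => ?_)
    · exact (ha.mul ((hTm N).const_mul _)).aestronglyMeasurable
    · exact (hasSum_partition m C hμ (measurable_thin_right hC hf x) hR0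
        (abs_thin_le C hb x)).mul_left (a x)
  have h3 := h2.mul_left μ
  rw [hasSum_nat_add_iff' 1 |>.symm] at h1
  simp only [Finset.range_one, Finset.sum_singleton, Finset.univ_eq_empty, Finset.sum_empty,
    integral_zero, mul_zero, sub_zero] at h1
  suffices key : ∀ N : ℕ, μ ^ (N + 1) / (N + 1).factorial *
      ∫ x in compatible C (N + 1), ∑ i, a (x i) * ∏ j ∈ Finset.univ.erase i, f (x j)
        ∂(Measure.pi fun _ => m) = μ * ∫ x, a x * (μ ^ N / N.factorial * T N x) ∂m by
    rw [funext key] at h1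
    exact h1.unique h3
  intro N
  have hi : ∀ i : Fin (N + 1), Integrable (fun x : Fin (N + 1) → X =>
      a (x i) * ∏ j ∈ Finset.univ.erase i, f (x j))
      ((Measure.pi fun _ => m).restrict (compatible C (N + 1))) := fun i =>
    integrable_of_abs_le (by fun_prop) (K := K * R ^ (Finset.univ.erase i).card) fun x => by
        rw [abs_mul]
        exact mul_le_mul (hK _) (abs_prod_le _ fun j => hb _) (abs_nonneg _) hK0
  rw [integral_finsetSum _ fun i _ => hi i]
  simp only [integral_sector_succ m hC hsymm ha hf hK hb, Finset.sum_const, Finset.card_univ,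
    Fintype.card_fin, nsmul_eq_mul, mul_left_comm (a _), integral_const_mul, hT]
  have h0 : (N.factorial : ℝ) ≠ 0 := by positivity
  have h4 : (N : ℝ) + 1 ≠ 0 := by positivity
  rw [Nat.factorial_succ]
  push_cast
  field_simp
  ring

theorem hasDerivAt_tilt (hμ : 0 ≤ μ) {S : (Σ N : ℕ, (Fin N → X)) → ℝ} (hS : Measurable S)
    {K R : ℝ} (hK : 0 ≤ K) (hR : 0 ≤ R) (hSb : ∀ ω, |S ω| ≤ K * R ^ ω.1)
    {f η : X → ℝ} (hf : Measurable f) (hη : Measurable η) {B : ℝ} (hB : 0 ≤ B)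
    (hfb : ∀ x, |f x| ≤ B) (hηb : ∀ x, |η x| ≤ B) (s₀ : ℝ) :
    HasDerivAt (fun s => ∫ ω, S ω * ∏ i, (f (ω.2 i) + s * η (ω.2 i)) ∂(gas m C μ))
      (∫ ω, S ω * ∑ i, η (ω.2 i) * ∏ j ∈ Finset.univ.erase i, (f (ω.2 j) + s₀ * η (ω.2 j))
        ∂(gas m C μ)) s₀ := by
  set R' : ℝ := 1 + B + (|s₀| + 1) * B with hR'
  have hR'1 : 1 ≤ R' := by
    have : 0 ≤ (|s₀| + 1) * B := by positivity
    linarith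
  have hR'0 : 0 ≤ R' := zero_le_one.trans hR'1
  have hm : ∀ s : ℝ, Measurable fun x => f x + s * η x := fun s => by fun_prop
  have hb : ∀ s ∈ Metric.ball s₀ 1, ∀ x, |f x + s * η x| ≤ R' := by
    intro s hs x
    have h1 : |s| ≤ |s₀| + 1 := by
      have := abs_sub_abs_le_abs_sub s s₀
      rw [Metric.mem_ball, Real.dist_eq] at hs
      linarith
    calc |f x + s * η x| ≤ |f x| + |s| * |η x| := by
          rw [← abs_mul]; exact abs_add_le _ _
      _ ≤ B + (|s₀| + 1) * B := by gcongr; exacts [hfb x, hηb x]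
      _ ≤ R' := by linarith
  have hball : Metric.ball s₀ 1 ∈ 𝓝 s₀ := Metric.ball_mem_nhds _ one_pos
  have hmul : ∀ {F : (Σ N : ℕ, (Fin N → X)) → ℝ} {K' T : ℝ}, 0 ≤ K' → 0 ≤ T →
      (∀ ω, |F ω| ≤ K' * T ^ ω.1) → ∀ ω, |S ω * F ω| ≤ (K * K') * (R * T) ^ ω.1 := by
    intro F K' T hK' hT hF ω
    rw [abs_mul, mul_pow]
    calc |S ω| * |F ω| ≤ (K * R ^ ω.1) * (K' * T ^ ω.1) := by
          gcongr; exacts [hSb ω, hF ω]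
      _ = _ := by ring
  refine (hasDerivAt_integral_of_dominated_loc_of_deriv_le
    (F' := fun s ω => S ω * ∑ i, η (ω.2 i) *
      ∏ j ∈ Finset.univ.erase i, (f (ω.2 j) + s * η (ω.2 j)))
    (bound := fun ω => (K * B) * (R * (2 * R')) ^ ω.1) hball ?_ ?_ ?_ ?_ ?_ ?_).2
  · exact Eventually.of_forall fun s =>
      (hS.mul (measurable_prod_config (hm s))).aestronglyMeasurable
  · refine integrable_gas m C hμ (hS.mul (measurable_prod_config (hm s₀)))
      (K := K * 1) (R := R * R') (by positivity) (by positivity) (hmul zero_le_one hR'0 fun ω => ?_)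
    simpa using abs_prod_le Finset.univ fun i => hb s₀ (Metric.mem_ball_self one_pos) (ω.2 i)
  · exact (hS.mul (measurable_sum_mul_prod_erase hη (hm s₀))).aestronglyMeasurable
  · exact Eventually.of_forall fun ω s hs => (Real.norm_eq_abs _).trans_le
      (hmul hB (by positivity) (abs_sum_mul_prod_erase_le hB hηb hR'1 (hb s hs)) ω)
  · refine integrable_gas m C hμ (measurable_sigma fun N =>
      (measurable_const : Measurable fun _ : Fin N → X => K * B * (R * (2 * R')) ^ N))
      (K := K * B) (R := R * (2 * R')) (by positivity) (by positivity) fun ω => ?_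
    rw [abs_of_nonneg (by positivity)]
  · refine Eventually.of_forall fun ω s _ => HasDerivAt.const_mul _ ?_
    have := HasDerivAt.fun_finsetProd (u := Finset.univ)
      (f := fun i (s : ℝ) => f (ω.2 i) + s * η (ω.2 i)) (f' := fun i => η (ω.2 i)) (x := s)
      fun i _ => by
        simpa using ((hasDerivAt_id s).mul_const (η (ω.2 i))).const_add (f (ω.2 i))
    simpa only [smul_eq_mul, mul_comm] using this

theorem hasDerivAt_partition (hμ : 0 ≤ μ) (hC : MeasurableSet {p : X × X | C p.1 p.2})
    (hsymm : ∀ x y, C x y → C y x)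
    {f η : X → ℝ} (hf : Measurable f) (hη : Measurable η) {B : ℝ} (hB : 0 ≤ B)
    (hfb : ∀ x, |f x| ≤ B) (hηb : ∀ x, |η x| ≤ B) (s₀ : ℝ) :
    HasDerivAt (fun s => partition m C μ fun x => f x + s * η x)
      (μ * ∫ x, η x * partition m C μ (thin C (fun x => f x + s₀ * η x) x) ∂m) s₀ := by
  have h := hasDerivAt_tilt m (C := C) hμ (S := fun _ => 1) measurable_const zero_le_one
    zero_le_one (by simp) hf hη hB hfb hηb s₀
  have hb : ∀ x, |f x + s₀ * η x| ≤ 1 + B + |s₀| * B := fun x =>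
    calc |f x + s₀ * η x| ≤ |f x| + |s₀| * |η x| := by
          rw [← abs_mul]; exact abs_add_le _ _
      _ ≤ B + |s₀| * B := by gcongr; exacts [hfb x, hηb x]
      _ ≤ _ := by linarith
  have hR : 1 ≤ 1 + B + |s₀| * B := by
    have : 0 ≤ |s₀| * B := by positivity
    linarith
  simp only [one_mul] at h
  rw [integral_sum_mul_prod_erase m hμ hC hsymm hη (by fun_prop) hB hηb hR hb] at h
  exact h

/-- A measurable relative activity with values in `[0, 2]`. -/
structure Admissible (f : X → ℝ) : Prop where
  measurable : Measurable f
  nonneg : ∀ x, 0 ≤ f x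
  le_two : ∀ x, f x ≤ 2

theorem Admissible.abs_le {f : X → ℝ} (hf : Admissible f) (x : X) : |f x| ≤ 2 := by
  rw [abs_of_nonneg (hf.nonneg x)]; exact hf.le_two x

theorem Admissible.abs_thin_sub_le {f : X → ℝ} (hf : Admissible f) (y x : X) :
    |HardCore.thin C f y x - f x| ≤ 2 := by
  unfold HardCore.thin
  split_ifs
  · simp
  · simpa using hf.abs_le x

theorem Admissible.thin (hC : MeasurableSet {p : X × X | C p.1 p.2}) {f : X → ℝ}
    (hf : Admissible f) (y : X) : Admissible (thin C f y) where
  measurable := measurable_thin_right hC hf.measurable y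
  nonneg x := by unfold HardCore.thin; split_ifs; exacts [hf.nonneg x, le_rfl]
  le_two x := by unfold HardCore.thin; split_ifs; exacts [hf.le_two x, zero_le_two]

theorem Admissible.interpolate (hC : MeasurableSet {p : X × X | C p.1 p.2}) {f : X → ℝ}
    (hf : Admissible f) (y : X) {s : ℝ} (h0 : 0 ≤ s) (h1 : s ≤ 1) :
    Admissible fun x => f x + s * (HardCore.thin C f y x - f x) where
  measurable := hf.measurable.add
    (((measurable_thin_right hC hf.measurable y).sub hf.measurable).const_mul s)
  nonneg x := by
    have := hf.nonneg x
    have := (hf.thin hC y).nonneg x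
    nlinarith
  le_two x := by
    have := hf.le_two x
    have := (hf.thin hC y).le_two x
    nlinarith

theorem one_le_partition (hμ : 0 ≤ μ) {f : X → ℝ} (hf : Admissible f) :
    1 ≤ partition m C μ f := by
  have h := hasSum_partition m C hμ hf.measurable zero_le_two hf.abs_le
  have h0 := le_hasSum h 0 fun N _ => mul_nonneg (by positivity)
    (integral_nonneg fun x => Finset.prod_nonneg fun i _ => hf.nonneg _)
  have hu : compatible C 0 = Set.univ := Set.eq_univ_of_forall fun x i => i.elim0
  simpa [hu] using h0

theorem partition_thin_le (hμ : 0 ≤ μ) (hC : MeasurableSet {p : X × X | C p.1 p.2}) {f : X → ℝ}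
    (hf : Admissible f) (y : X) : partition m C μ (thin C f y) ≤ partition m C μ f := by
  have hi : ∀ {g : X → ℝ}, Admissible g →
      Integrable (fun ω : Σ N : ℕ, (Fin N → X) => ∏ i, g (ω.2 i)) (gas m C μ) := fun {g} hg =>
    integrable_gas m C hμ (measurable_prod_config hg.measurable) zero_le_one zero_le_two
      fun ω => by simpa using abs_prod_le Finset.univ fun i => hg.abs_le (ω.2 i)
  refine integral_mono (hi (hf.thin hC y)) (hi hf) fun ω =>
    Finset.prod_le_prod (fun i _ => (hf.thin hC y).nonneg _) fun i _ => ?_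
  unfold thin
  split_ifs
  exacts [le_rfl, hf.nonneg _]

variable (C μ) in
/-- The probability that no point of the gas with relative activity `f` is incompatible
with `y`. -/
def ratio (f : X → ℝ) (y : X) : ℝ := partition m C μ (thin C f y) / partition m C μ f

theorem ratio_pos (hμ : 0 ≤ μ) (hC : MeasurableSet {p : X × X | C p.1 p.2}) {f : X → ℝ}
    (hf : Admissible f) (y : X) : 0 < ratio m C μ f y :=
  div_pos (zero_lt_one.trans_le (one_le_partition m hμ (hf.thin hC y)))
    (zero_lt_one.trans_le (one_le_partition m hμ hf))

theorem ratio_le_one (hμ : 0 ≤ μ) (hC : MeasurableSet {p : X × X | C p.1 p.2}) {f : X → ℝ}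
    (hf : Admissible f) (y : X) : ratio m C μ f y ≤ 1 :=
  div_le_one_of_le₀ (partition_thin_le m hμ hC hf y)
    (zero_le_one.trans (one_le_partition m hμ hf))

theorem measurable_ratio (hμ : 0 ≤ μ) (hC : MeasurableSet {p : X × X | C p.1 p.2}) {f : X → ℝ}
    (hf : Admissible f) : Measurable (ratio m C μ f) :=
  (measurable_partition_thin m hμ hC hf.measurable zero_le_two hf.abs_le).div_const _

theorem abs_mul_ratio_sub_le (hμ : 0 ≤ μ) (hC : MeasurableSet {p : X × X | C p.1 p.2})
    {f g : X → ℝ} (hf : Admissible f) {u v δ K : ℝ} (x : X)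
    (huv : |u - v| ≤ δ) (hv : |v| ≤ 2) (hK : |ratio m C μ f x - ratio m C μ g x| ≤ K) :
    |u * ratio m C μ f x - v * ratio m C μ g x| ≤ δ + 2 * K := by
  have h1 : u * ratio m C μ f x - v * ratio m C μ g x
      = (u - v) * ratio m C μ f x + v * (ratio m C μ f x - ratio m C μ g x) := by ring
  rw [h1]
  refine (abs_add_le _ _).trans (add_le_add ?_ ?_)
  · rw [abs_mul, abs_of_pos (ratio_pos m hμ hC hf x)]
    exact (mul_le_of_le_one_right (abs_nonneg _) (ratio_le_one m hμ hC hf x)).trans huv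
  · rw [abs_mul]
    exact mul_le_mul hv hK (abs_nonneg _) zero_le_two

theorem abs_sub_le_abs_log_sub_log {a b : ℝ} (ha : 0 < a) (hb : 0 < b) (ha1 : a ≤ 1)
    (hb1 : b ≤ 1) : |a - b| ≤ |Real.log a - Real.log b| := by
  wlog hab : a ≤ b generalizing a b
  · rw [abs_sub_comm, abs_sub_comm (Real.log a)]
    exact this hb ha hb1 ha1 (le_of_not_ge hab)
  have h := Real.one_sub_inv_le_log_of_pos (div_pos hb ha)
  rw [Real.log_div hb.ne' ha.ne', inv_div] at h
  have h2 : b - a ≤ 1 - a / b := by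
    rw [one_sub_div hb.ne', le_div_iff₀ hb]
    nlinarith
  rw [abs_sub_comm, abs_sub_comm (Real.log a), abs_of_nonneg (sub_nonneg.2 hab)]
  exact (h2.trans h).trans (le_abs_self _)

theorem hasDerivAt_log_partition (hμ : 0 ≤ μ) (hC : MeasurableSet {p : X × X | C p.1 p.2})
    (hsymm : ∀ x y, C x y → C y x) {f : X → ℝ} (hf : Admissible f) (y : X) {s : ℝ}
    (h0 : 0 ≤ s) (h1 : s ≤ 1) :
    HasDerivAt (fun s => Real.log (partition m C μ fun x => f x + s * (thin C f y x - f x)))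
      (μ * ∫ x, (thin C f y x - f x) *
        ratio m C μ (fun x => f x + s * (thin C f y x - f x)) x ∂m) s := by
  have h := (hasDerivAt_partition m hμ hC hsymm hf.measurable
    ((measurable_thin_right hC hf.measurable y).sub hf.measurable) zero_le_two hf.abs_le (hf.abs_thin_sub_le y) s).log
    (zero_lt_one.trans_le (one_le_partition m hμ (hf.interpolate hC y h0 h1))).ne'
  simp only [Pi.sub_apply] at h
  convert h using 1
  rw [mul_div_assoc, ← integral_div]
  simp only [ratio, mul_div_assoc]

theorem abs_ratio_sub_ratio_le_aux (hμ : 0 ≤ μ) (hC : MeasurableSet {p : X × X | C p.1 p.2})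
    (hsymm : ∀ x y, C x y → C y x) {κ : ℝ} (hκ : ∀ y, μ * m.real {x | ¬ C y x} ≤ κ)
    (hκ0 : 0 ≤ κ) (hκ1 : κ ≤ 1 / 4) {δ : ℝ} (hδ : 0 ≤ δ) (n : ℕ) :
    ∀ {f g : X → ℝ}, Admissible f → Admissible g → (∀ x, |f x - g x| ≤ δ) → ∀ y,
      |ratio m C μ f y - ratio m C μ g y| ≤ 2 * κ * δ + (1 / 2) ^ n := by
  induction n with
  | zero =>
    intro f g hf hg _ y
    have h1 := ratio_pos m hμ hC hf y
    have h2 := ratio_pos m hμ hC hg y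
    have h3 := ratio_le_one m hμ hC hf y
    have h4 := ratio_le_one m hμ hC hg y
    have h5 : 0 ≤ 2 * κ * δ := by positivity
    rw [abs_le, pow_zero]
    constructor <;> linarith
  | succ n ih =>
    intro f g hf hg hfg y
    set K : ℝ := 2 * κ * δ + (1 / 2) ^ n with hKdef
    have hK0 : 0 ≤ K := by positivity
    let p : (X → ℝ) → ℝ → X → ℝ := fun f s x => f x + s * (thin C f y x - f x)
    have hp : ∀ {f : X → ℝ}, Admissible f → ∀ {s : ℝ}, s ∈ Set.Icc (0 : ℝ) 1 →
        Admissible (p f s) := fun hf _ hs => hf.interpolate hC y hs.1 hs.2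
    have hint : ∀ {f : X → ℝ}, Admissible f → ∀ {s : ℝ}, s ∈ Set.Icc (0 : ℝ) 1 →
        Integrable (fun x => (thin C f y x - f x) * ratio m C μ (p f s) x) m := by
      intro f hf s hs
      refine integrable_of_abs_le (((measurable_thin_right hC hf.measurable y).sub
        hf.measurable).mul (measurable_ratio m hμ hC (hp hf hs))) (K := 2) fun x => ?_
      have h1 := ratio_pos m hμ hC (hp hf hs) x
      rw [abs_mul, abs_of_pos h1]
      exact (mul_le_of_le_one_right (abs_nonneg _) (ratio_le_one m hμ hC (hp hf hs) x)).trans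
        (hf.abs_thin_sub_le y x)
    have hmv := norm_image_sub_le_of_norm_deriv_le_segment_01' (C := κ * (δ + 2 * K))
      (f := fun s => Real.log (partition m C μ (p f s)) - Real.log (partition m C μ (p g s)))
      (fun s hs => ((hasDerivAt_log_partition m hμ hC hsymm hf y hs.1 hs.2).sub
        (hasDerivAt_log_partition m hμ hC hsymm hg y hs.1 hs.2)).hasDerivWithinAt)
      fun s hs => ?_
    · have hp0 : ∀ f : X → ℝ, p f 0 = f := fun f => by funext x; simp [p]
      have hp1 : ∀ f : X → ℝ, p f 1 = thin C f y := fun f => by funext x; simp [p]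
      have hlog : ∀ {f : X → ℝ}, Admissible f → Real.log (ratio m C μ f y)
          = Real.log (partition m C μ (thin C f y)) - Real.log (partition m C μ f) := fun hf =>
        Real.log_div (zero_lt_one.trans_le (one_le_partition m hμ (hf.thin hC y))).ne'
          (zero_lt_one.trans_le (one_le_partition m hμ hf)).ne'
      refine (abs_sub_le_abs_log_sub_log (ratio_pos m hμ hC hf y) (ratio_pos m hμ hC hg y)
        (ratio_le_one m hμ hC hf y) (ratio_le_one m hμ hC hg y)).trans ?_
      simp only [hp0, hp1, Real.norm_eq_abs] at hmv
      rw [hlog hf, hlog hg]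
      have hfin : κ * (δ + 2 * K) ≤ 2 * κ * δ + (1 / 2) ^ (n + 1) := by
        have e1 : 0 ≤ κ * δ := by positivity
        have e2 : (0 : ℝ) < (1 / 2) ^ n := by positivity
        rw [hKdef, pow_succ]
        nlinarith
      refine le_trans (le_of_eq ?_) (hmv.trans hfin)
      congr 1
      ring
    · have hs' : s ∈ Set.Icc (0 : ℝ) 1 := ⟨hs.1, hs.2.le⟩
      rw [← mul_sub, ← integral_sub (hint hf hs') (hint hg hs'), Real.norm_eq_abs, abs_mul,
        abs_of_nonneg hμ]
      have hBm : MeasurableSet {x | ¬ C y x} :=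
        ((measurable_const.prodMk measurable_id : Measurable fun x : X => (y, x)) hC).compl
      have hpt : ∀ x, |(thin C f y x - f x) * ratio m C μ (p f s) x
          - (thin C g y x - g x) * ratio m C μ (p g s) x|
          ≤ {x | ¬ C y x}.indicator (fun _ => δ + 2 * K) x := by
        intro x
        by_cases hx : C y x
        · simp [thin, hx]
        · rw [Set.indicator_of_mem (by exact hx)]
          refine abs_mul_ratio_sub_le m hμ hC (hp hf hs') x ?_ ?_
            (ih (hp hf hs') (hp hg hs') (fun z => ?_) x)
          · simpa [thin, hx, abs_sub_comm, neg_add_eq_sub] using hfg x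
          · simpa [thin, hx] using hg.abs_le x
          · by_cases hz : C y z
            · simpa [p, thin, hz] using hfg z
            · have : p f s z - p g s z = (1 - s) * (f z - g z) := by
                simp only [p, thin, hz, if_false]; ring
              rw [this, abs_mul, abs_of_nonneg (sub_nonneg.2 hs'.2)]
              exact (mul_le_of_le_one_left (abs_nonneg _) (by linarith [hs'.1])).trans (hfg z)
      have hle : |∫ x, ((thin C f y x - f x) * ratio m C μ (p f s) x
          - (thin C g y x - g x) * ratio m C μ (p g s) x) ∂m|
          ≤ m.real {x | ¬ C y x} * (δ + 2 * K) := by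
        refine abs_integral_le_integral_abs.trans ?_
        refine (integral_mono ((hint hf hs').sub (hint hg hs')).abs
          ((integrable_const _).indicator hBm) hpt).trans_eq ?_
        rw [integral_indicator_const _ hBm, smul_eq_mul]
      calc _ ≤ μ * (m.real {x | ¬ C y x} * (δ + 2 * K)) := by gcongr
        _ = (μ * m.real {x | ¬ C y x}) * (δ + 2 * K) := by ring
        _ ≤ κ * (δ + 2 * K) := by gcongr; exact hκ y

/-- Lipschitz dependence of the insertion probability on the activity, for dilute gases. -/
theorem abs_ratio_sub_ratio_le (hμ : 0 ≤ μ) (hC : MeasurableSet {p : X × X | C p.1 p.2})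
    (hsymm : ∀ x y, C x y → C y x) {κ : ℝ} (hκ : ∀ y, μ * m.real {x | ¬ C y x} ≤ κ)
    (hκ0 : 0 ≤ κ) (hκ1 : κ ≤ 1 / 4) {δ : ℝ} (hδ : 0 ≤ δ) {f g : X → ℝ} (hf : Admissible f)
    (hg : Admissible g) (hfg : ∀ x, |f x - g x| ≤ δ) (y : X) :
    |ratio m C μ f y - ratio m C μ g y| ≤ 2 * κ * δ := by
  have ht : Tendsto (fun n : ℕ => 2 * κ * δ + (1 / 2 : ℝ) ^ n) atTop (𝓝 (2 * κ * δ + 0)) :=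
    (tendsto_pow_atTop_nhds_zero_of_lt_one (by norm_num) (by norm_num)).const_add _
  rw [add_zero] at ht
  exact ge_of_tendsto' ht fun n =>
    abs_ratio_sub_ratio_le_aux m hμ hC hsymm hκ hκ0 hκ1 hδ n hf hg hfg y

theorem abs_one_sub_ratio_le (hμ : 0 ≤ μ) (hC : MeasurableSet {p : X × X | C p.1 p.2})
    (hsymm : ∀ x y, C x y → C y x) {κ : ℝ} (hκ : ∀ y, μ * m.real {x | ¬ C y x} ≤ κ)
    (hκ0 : 0 ≤ κ) (hκ1 : κ ≤ 1 / 4) (y : X) : |1 - ratio m C μ (fun _ => 1) y| ≤ 2 * κ := by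
  have h0 : Admissible fun _ : X => (0 : ℝ) := ⟨measurable_const, fun _ => le_rfl, by simp⟩
  have h1 : Admissible fun _ : X => (1 : ℝ) := ⟨measurable_const, by simp, by simp⟩
  have h := abs_ratio_sub_ratio_le m hμ hC hsymm hκ hκ0 hκ1 zero_le_one h0 h1 (by simp) y
  have ht : thin C (fun _ => 0) y = fun _ => 0 := by funext x; simp [thin]
  rwa [ratio, ht, div_self (zero_lt_one.trans_le (one_le_partition m hμ h0)).ne', mul_one] at h

theorem measurable_sum_config {a : X → ℝ} (ha : Measurable a) :
    Measurable fun ω : Σ N : ℕ, (Fin N → X) => ∑ i, a (ω.2 i) :=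
  measurable_sigma fun N => Finset.measurable_sum (f := fun i (x : Fin N → X) => a (x i))
    Finset.univ fun i _ => by fun_prop

omit [MeasurableSpace X] in
theorem abs_sum_config_le {a : X → ℝ} {A : ℝ} (hA0 : 0 ≤ A) (hA : ∀ x, |a x| ≤ A)
    (ω : Σ N : ℕ, (Fin N → X)) : |∑ i, a (ω.2 i)| ≤ A * 2 ^ ω.1 :=
  calc |∑ i, a (ω.2 i)| ≤ ∑ i, |a (ω.2 i)| := Finset.abs_sum_le_sum_abs _ _
    _ ≤ ∑ _i : Fin ω.1, A := Finset.sum_le_sum fun i _ => hA _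
    _ = ω.1 * A := by simp
    _ ≤ 2 ^ ω.1 * A := by gcongr; exact natCast_le_two_pow _
    _ = _ := mul_comm _ _

theorem integral_sum_mul_prod_div_partition (hμ : 0 ≤ μ)
    (hC : MeasurableSet {p : X × X | C p.1 p.2}) (hsymm : ∀ x y, C x y → C y x)
    {a f : X → ℝ} (ha : Measurable a) (hf : Admissible f) {A : ℝ} (hA0 : 0 ≤ A)
    (hA : ∀ x, |a x| ≤ A) :
    (∫ ω, (∑ i, a (ω.2 i)) * ∏ i, f (ω.2 i) ∂(gas m C μ)) / partition m C μ f
      = μ * ∫ x, a x * f x * ratio m C μ f x ∂m := by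
  have h : ∀ ω : Σ N : ℕ, (Fin N → X), (∑ i, a (ω.2 i)) * ∏ i, f (ω.2 i)
      = ∑ i, (a (ω.2 i) * f (ω.2 i)) * ∏ j ∈ Finset.univ.erase i, f (ω.2 j) := fun ω => by
    rw [Finset.sum_mul]
    refine Finset.sum_congr rfl fun i hi => ?_
    rw [mul_assoc, Finset.mul_prod_erase _ (fun j => f (ω.2 j)) hi]
  have hb : ∀ x, |a x * f x| ≤ A * 2 := fun x => by
    rw [abs_mul]
    exact mul_le_mul (hA x) (hf.abs_le x) (abs_nonneg _) hA0
  simp only [h]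
  rw [integral_sum_mul_prod_erase m hμ hC hsymm (a := fun x => a x * f x) (ha.mul hf.measurable) hf.measurable
    (by positivity) hb one_le_two hf.abs_le, mul_div_assoc, ← integral_div]
  simp only [ratio, mul_div_assoc]

/-- Quantitative decorrelation for dilute hard-core gases: the covariance of two linear
statistics is close to that of a Poisson process. -/
theorem abs_covariance_sub_le (hμ : 0 ≤ μ) (hC : MeasurableSet {p : X × X | C p.1 p.2})
    (hsymm : ∀ x y, C x y → C y x) {κ : ℝ} (hκ : ∀ y, μ * m.real {x | ¬ C y x} ≤ κ)
    (hκ0 : 0 ≤ κ) (hκ1 : κ ≤ 1 / 4) {a b : X → ℝ} (ha : Measurable a) (hb : Measurable b)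
    {A B : ℝ} (hA0 : 0 ≤ A) (hB0 : 0 ≤ B) (hA : ∀ x, |a x| ≤ A) (hB : ∀ x, |b x| ≤ B) :
    |(∫ ω, (∑ i, a (ω.2 i)) * (∑ i, b (ω.2 i)) ∂(gas m C μ)) / partition m C μ (fun _ => 1)
      - (∫ ω, ∑ i, a (ω.2 i) ∂(gas m C μ)) / partition m C μ (fun _ => 1) *
        ((∫ ω, ∑ i, b (ω.2 i) ∂(gas m C μ)) / partition m C μ (fun _ => 1))
      - μ * ∫ x, a x * b x ∂m| ≤ 6 * A * B * κ * μ := by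
  have h1 : Admissible fun _ : X => (1 : ℝ) := ⟨measurable_const, by simp, by simp⟩
  set Z := partition m C μ fun _ => 1 with hZ
  have hZ0 : Z ≠ 0 := (zero_lt_one.trans_le (one_le_partition m hμ h1)).ne'
  set ρ : ℝ → X → ℝ := fun t => ratio m C μ fun x => 1 + t * b x with hρ
  have hadm : ∀ {t : ℝ}, |t| * B ≤ 1 → Admissible fun x => 1 + t * b x := by
    intro t ht
    have hx : ∀ x, |t * b x| ≤ 1 := fun x => by
      rw [abs_mul]
      exact (mul_le_mul_of_nonneg_left (hB x) (abs_nonneg t)).trans ht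
    exact ⟨by fun_prop, fun x => by linarith [(abs_le.1 (hx x)).1],
      fun x => by linarith [(abs_le.1 (hx x)).2]⟩
  have hρ0 : ρ 0 = ratio m C μ fun _ => 1 := by simp [hρ]
  have hb1 : ∀ x, |b x| ≤ 1 + B := fun x => (hB x).trans (by linarith)
  have hJ := hasDerivAt_tilt m (C := C) hμ (measurable_sum_config ha) hA0 zero_le_two
    (abs_sum_config_le hA0 hA) (f := fun _ => 1) measurable_const hb (B := 1 + B)
    (by positivity) (fun _ => by rw [abs_one]; linarith) hb1 0
  have hP := hasDerivAt_tilt m (C := C) hμ (S := fun _ => 1) measurable_const zero_le_one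
    zero_le_one (by simp) (f := fun _ => 1) measurable_const hb (B := 1 + B)
    (by positivity) (fun _ => by rw [abs_one]; linarith) hb1 0
  simp only [zero_mul, add_zero, Finset.prod_const_one, mul_one, one_mul] at hJ hP
  have hq := hJ.div hP (by simp only [zero_mul, add_zero]; exact hZ0)
  set D := μ * ∫ x, a x * b x * ρ 0 x ∂m with hD
  have hder := hq.sub ((hasDerivAt_id (0 : ℝ)).mul_const D)
  have hnear : ∀ᶠ t : ℝ in 𝓝 0, |t| * B ≤ 1 := by
    have : Tendsto (fun t : ℝ => |t| * B) (𝓝 0) (𝓝 (|0| * B)) :=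
      (continuous_abs.mul continuous_const).tendsto 0
    rw [abs_zero, zero_mul] at this
    exact this.eventually_le_const one_pos
  have hm : ∀ {t : ℝ}, |t| * B ≤ 1 →
      (∫ ω, (∑ i, a (ω.2 i)) * ∏ i, (1 + t * b (ω.2 i)) ∂(gas m C μ)) /
        (∫ ω, ∏ i, (1 + t * b (ω.2 i)) ∂(gas m C μ))
      = μ * ∫ x, a x * (1 + t * b x) * ρ t x ∂m := fun ht =>
    integral_sum_mul_prod_div_partition m hμ hC hsymm ha (hadm ht) hA0 hA
  have hzero : |(0 : ℝ)| * B ≤ 1 := by simp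
  have hi : ∀ {t : ℝ}, |t| * B ≤ 1 → ∀ {u : X → ℝ}, Measurable u → ∀ {U : ℝ},
      (∀ x, |u x| ≤ U) → Integrable (fun x => u x * ρ t x) m := by
    intro t ht u hu U hU
    refine integrable_of_abs_le (hu.mul (measurable_ratio m hμ hC (hadm ht))) (K := U) fun x => ?_
    rw [abs_mul, abs_of_pos (ratio_pos m hμ hC (hadm ht) x)]
    exact (mul_le_of_le_one_right (abs_nonneg _) (ratio_le_one m hμ hC (hadm ht) x)).trans (hU x)
  have habs : ∀ {u v : X → ℝ} {U V : ℝ}, (∀ x, |u x| ≤ U) → (∀ x, |v x| ≤ V) → 0 ≤ U →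
      ∀ x, |u x * v x| ≤ U * V := fun hu hv hU x => by
    rw [abs_mul]
    exact mul_le_mul (hu x) (hv x) (abs_nonneg _) hU
  have hlip := hder.le_of_lip' (C := 4 * A * B * κ * μ) (by positivity) (by
    filter_upwards [hnear] with t ht
    simp only [Pi.sub_apply, Pi.div_apply, id_eq, Real.norm_eq_abs]
    rw [hm ht, hm hzero]
    simp only [zero_mul, sub_zero, add_zero, mul_one]
    have e : μ * ∫ x, a x * (1 + t * b x) * ρ t x ∂m = μ * ∫ x, a x * ρ 0 x ∂m + t * D
        + μ * ∫ x, a x * (1 + t * b x) * (ρ t x - ρ 0 x) ∂m := by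
      have i1 := hi ht (ha.mul (hadm ht).measurable) (habs hA (hadm ht).abs_le hA0)
      have i2 := hi hzero (ha.mul (hadm ht).measurable) (habs hA (hadm ht).abs_le hA0)
      have i3 := hi hzero ha hA
      have i4 := hi hzero (ha.mul hb) (habs hA hB hA0)
      simp only [Pi.mul_apply] at i1 i2 i4
      have e1 : ∫ x, a x * (1 + t * b x) * (ρ t x - ρ 0 x) ∂m
          = ∫ x, a x * (1 + t * b x) * ρ t x ∂m - ∫ x, a x * (1 + t * b x) * ρ 0 x ∂m := by
        rw [← integral_sub i1 i2]
        simp only [mul_sub]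
      have e2 : ∫ x, a x * (1 + t * b x) * ρ 0 x ∂m
          = ∫ x, a x * ρ 0 x ∂m + t * ∫ x, a x * b x * ρ 0 x ∂m := by
        rw [← integral_const_mul, ← integral_add i3 (i4.const_mul t)]
        exact integral_congr_ae (Eventually.of_forall fun x => by ring)
      rw [e1, e2, hD]
      ring
    rw [e]
    have hbound : |∫ x, a x * (1 + t * b x) * (ρ t x - ρ 0 x) ∂m|
        ≤ A * 2 * (2 * κ * (|t| * B)) := by
      have hρt : ∀ x, |ρ t x - ρ 0 x| ≤ 2 * κ * (|t| * B) :=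
        abs_ratio_sub_ratio_le m hμ hC hsymm hκ hκ0 hκ1 (by positivity) (hadm ht) (hadm hzero)
          fun x => by
            simp only [zero_mul, add_zero, add_sub_cancel_left, abs_mul]
            exact mul_le_mul_of_nonneg_left (hB x) (abs_nonneg t)
      have := norm_integral_le_of_norm_le_const (μ := m)
        (Eventually.of_forall fun x => (Real.norm_eq_abs _).trans_le
          (habs (habs hA (hadm ht).abs_le hA0) hρt (by positivity) x))
      simpa using this
    have e3 : ∀ u v w : ℝ, u + v + w - v - u = w := fun u v w => by ring
    rw [e3, abs_mul, abs_of_nonneg hμ]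
    calc _ ≤ μ * (A * 2 * (2 * κ * (|t| * B))) := by gcongr
      _ = _ := by ring)
  have hmain : |D - μ * ∫ x, a x * b x ∂m| ≤ 2 * A * B * κ * μ := by
    have i1 := hi hzero (ha.mul hb) (habs hA hB hA0)
    have i2 : Integrable (fun x => a x * b x) m :=
      integrable_of_abs_le (ha.mul hb) (habs hA hB hA0)
    simp only [Pi.mul_apply] at i1
    have hρ1 : ∀ x, |ρ 0 x - 1| ≤ 2 * κ := fun x => by
      rw [hρ0, abs_sub_comm]
      exact abs_one_sub_ratio_le m hμ hC hsymm hκ hκ0 hκ1 x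
    have := norm_integral_le_of_norm_le_const (μ := m)
      (Eventually.of_forall fun x => (Real.norm_eq_abs _).trans_le
        (habs (habs hA hB hA0) hρ1 (by positivity) x))
    simp only [mul_sub, mul_one, Real.norm_eq_abs, probReal_univ] at this
    rw [integral_sub i1 i2] at this
    rw [hD, ← mul_sub, abs_mul, abs_of_nonneg hμ]
    calc _ ≤ μ * (A * B * (2 * κ)) := by gcongr
      _ = _ := by ring
  have hZint : ∫ ω, 1 ∂(gas m C μ) = Z := by simp [hZ, partition]
  simp only [zero_mul, add_zero, Finset.prod_const_one, mul_one, hZint, one_mul,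
    Real.norm_eq_abs] at hlip
  refine le_trans (le_of_eq ?_) ((abs_add_le _ _).trans
    ((add_le_add hlip hmain).trans_eq (by ring)))
  congr 1
  field_simp
  ring

end Integration

end HardCore

theorem lintegral_pi_fin_prod {X : Type*} [MeasurableSpace X] (ν : Measure X) [SigmaFinite ν]
    {N : ℕ} {g : Fin N → X → ENNReal} (hg : ∀ i, Measurable (g i)) :
    ∫⁻ x, ∏ i, g i (x i) ∂(Measure.pi fun _ : Fin N => ν) = ∏ i, ∫⁻ x, g i x ∂ν := by
  induction N with
  | zero => simp
  | succ N ih =>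
    have hmp := (measurePreserving_piFinSuccAbove (fun _ : Fin (N + 1) => ν) 0).symm
    rw [← hmp.lintegral_comp (by fun_prop), Fin.prod_univ_succ, ← ih fun i => hg i.succ,
      ← lintegral_prod_mul (hg 0).aemeasurable (Finset.measurable_prod Finset.univ fun i _ =>
        (hg i.succ).comp (measurable_pi_apply i)).aemeasurable]
    refine lintegral_congr fun p => ?_
    simp [Fin.prod_univ_succ, MeasurableEquiv.piFinSuccAbove, Fin.insertNthEquiv]

theorem pi_withDensity_fin {X : Type*} [MeasurableSpace X] (ν : Measure X) [SigmaFinite ν]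
    {g : X → ENNReal} (hg : Measurable g) [SigmaFinite (ν.withDensity g)] (N : ℕ) :
    (Measure.pi fun _ : Fin N => ν.withDensity g)
      = (Measure.pi fun _ : Fin N => ν).withDensity fun x => ∏ i, g (x i) := by
  refine Measure.pi_eq fun s hs => ?_
  rw [withDensity_apply _ (MeasurableSet.univ_pi hs),
    ← lintegral_indicator (MeasurableSet.univ_pi hs)]
  calc _ = ∫⁻ x, ∏ i, (s i).indicator g (x i) ∂(Measure.pi fun _ : Fin N => ν) := by
        refine lintegral_congr fun x => ?_
        by_cases hx : x ∈ Set.univ.pi s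
        · rw [Set.indicator_of_mem hx]
          exact Finset.prod_congr rfl fun i _ => (Set.indicator_of_mem (hx i trivial) _).symm
        · rw [Set.indicator_of_notMem hx]
          obtain ⟨i, hi⟩ : ∃ i, x i ∉ s i := by simpa [Set.mem_univ_pi] using hx
          exact (Finset.prod_eq_zero (Finset.mem_univ i) (Set.indicator_of_notMem hi _)).symm
    _ = _ := by
        rw [lintegral_pi_fin_prod ν fun i => hg.indicator (hs i)]
        exact Finset.prod_congr rfl fun i _ => by
          rw [lintegral_indicator (hs i), withDensity_apply _ (hs i)]

namespace HardSphere

open HardCore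

variable {d : ℕ}

theorem measurable_Maxw : Measurable (Maxw d) := by
  unfold Maxw
  fun_prop

theorem Maxw_pos (v : Rd d) : 0 < Maxw d v := by
  unfold Maxw
  positivity

theorem integral_Maxw : ∫ v, Maxw d v = 1 := by
  have h := GaussianFourier.integral_rexp_neg_mul_sq_norm (V := Rd d) (b := 1 / 2) (by norm_num)
  have e : ∀ v : Rd d, Maxw d v = (2 * π) ^ (-(d : ℝ) / 2) * Real.exp (-(1 / 2) * ‖v‖ ^ 2) :=
    fun v => by unfold Maxw; ring_nf
  simp only [e]
  rw [integral_const_mul, h, finrank_euclideanSpace_fin, div_div_eq_mul_div, div_one, mul_comm π 2,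
    ← Real.rpow_add (by positivity), neg_div, neg_add_cancel, Real.rpow_zero]

theorem lintegral_Maxw : ∫⁻ v, ENNReal.ofReal (Maxw d v) = 1 := by
  have hi : Integrable (Maxw d) := by
    by_contra h
    simpa [integral_undef h] using integral_Maxw (d := d)
  rw [← ofReal_integral_eq_lintegral_ofReal hi (Eventually.of_forall fun v => (Maxw_pos v).le),
    integral_Maxw, ENNReal.ofReal_one]

variable (d) in
/-- The one-particle equilibrium law. -/
def particleLaw : Measure (Torus d × Rd d) :=
  volume.withDensity fun z => ENNReal.ofReal (Maxw d z.2)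

theorem particleLaw_eq_prod : particleLaw d =
    (volume : Measure (Torus d)).prod
      ((volume : Measure (Rd d)).withDensity fun v => ENNReal.ofReal (Maxw d v)) :=
  (prod_withDensity_right measurable_Maxw.ennreal_ofReal).symm

instance : IsProbabilityMeasure
    ((volume : Measure (Rd d)).withDensity fun v => ENNReal.ofReal (Maxw d v)) :=
  ⟨by rw [withDensity_apply _ MeasurableSet.univ, setLIntegral_univ, lintegral_Maxw]⟩

instance : IsProbabilityMeasure (volume : Measure UnitAddCircle) :=
  ⟨UnitAddCircle.measure_univ⟩

instance : IsProbabilityMeasure (particleLaw d) := by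
  rw [particleLaw_eq_prod]
  infer_instance

theorem measurePreserving_fst_particleLaw :
    MeasurePreserving Prod.fst (particleLaw d) (volume : Measure (Torus d)) := by
  rw [particleLaw_eq_prod]
  exact measurePreserving_fst

variable (d) in
/-- Two particles are compatible when their positions are at distance more than `ε`. -/
def separated (ε : ℝ) (z z' : Torus d × Rd d) : Prop := ε < dist z.1 z'.1

theorem separated_symm {ε : ℝ} (z z' : Torus d × Rd d) (h : separated d ε z z') :
    separated d ε z' z := by
  unfold separated at *
  rwa [dist_comm]

theorem measurableSet_separated (ε : ℝ) :
    MeasurableSet {p : (Torus d × Rd d) × (Torus d × Rd d) | separated d ε p.1 p.2} :=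
  measurableSet_lt measurable_const
    ((measurable_fst.comp measurable_fst).dist (measurable_fst.comp measurable_snd))

theorem particleLaw_not_separated_le {ε : ℝ} (hε : 0 ≤ ε) (y : Torus d × Rd d) :
    (particleLaw d).real {x | ¬ separated d ε y x} ≤ (2 * ε) ^ d := by
  have e : {x | ¬ separated d ε y x} = Prod.fst ⁻¹' Metric.closedBall y.1 ε := by
    ext x
    simp [separated, dist_comm]
  rw [e, measureReal_def, measurePreserving_fst_particleLaw.measure_preimage
    Metric.isClosed_closedBall.measurableSet.nullMeasurableSet, MeasureTheory.volume_pi_closedBall _ hε]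
  simp only [AddCircle.volume_closedBall, ENNReal.toReal_prod]
  refine (Finset.prod_le_prod (g := fun _ => 2 * ε) (fun _ _ => ENNReal.toReal_nonneg)
    fun i _ => ?_).trans_eq (by simp)
  rw [ENNReal.toReal_ofReal (by positivity)]
  exact min_le_right _ _

theorem compatible_separated (ε : ℝ) (N : ℕ) :
    compatible (separated d ε) N = (fun (x : Fin N → Torus d × Rd d) i => (x i).1) ⁻¹' excl d ε N :=
  rfl

theorem withDensity_sectorDens (ε : ℝ) {μ : ℝ} (hμ : 0 ≤ μ) (N : ℕ) :
    (volume.withDensity fun Z => ENNReal.ofReal (sectorDens d ε μ N Z))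
      = ENNReal.ofReal (μ ^ N / N.factorial) •
        (Measure.pi fun _ => particleLaw d).restrict (compatible (separated d ε) N) := by
  have hms := measurableSet_compatible (measurableSet_separated (d := d) ε) N
  have hg : Measurable fun z : Torus d × Rd d => ENNReal.ofReal (Maxw d z.2) :=
    (measurable_Maxw.comp measurable_snd).ennreal_ofReal
  have hprod : Measurable fun x : Fin N → Torus d × Rd d => ∏ i, ENNReal.ofReal (Maxw d (x i).2) :=
    Finset.measurable_prod _ fun i _ => hg.comp (measurable_pi_apply i)
  have : SigmaFinite ((volume : Measure (Torus d × Rd d)).withDensity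
      fun z => ENNReal.ofReal (Maxw d z.2)) := inferInstanceAs (SigmaFinite (particleLaw d))
  have hpi : (Measure.pi fun _ : Fin N => particleLaw d) =
      volume.withDensity fun x => ∏ i, ENNReal.ofReal (Maxw d (x i).2) :=
    pi_withDensity_fin volume hg N
  rw [hpi, restrict_withDensity hms, ← withDensity_indicator hms,
    ← withDensity_smul _ (hprod.indicator hms)]
  congr 1
  ext Z
  rw [sectorDens, ENNReal.ofReal_mul (by positivity), ENNReal.ofReal_mul (by positivity),
    ENNReal.ofReal_prod_of_nonneg fun i _ => (Maxw_pos _).le, mul_assoc, Pi.smul_apply, smul_eq_mul,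
    compatible_separated]
  congr 1
  have hmem : (Z ∈ (fun (x : Fin N → Torus d × Rd d) i => (x i).1) ⁻¹' excl d ε N) ↔
      (fun i => (Z i).1) ∈ excl d ε N := Iff.rfl
  by_cases h : (fun i => (Z i).1) ∈ excl d ε N
  · rw [if_pos h, Set.indicator_of_mem (hmem.2 h)]
    simp
  · rw [if_neg h, Set.indicator_of_notMem (mt hmem.1 h)]
    simp

theorem partFun_eq_partition (ε : ℝ) {μ : ℝ} (hμ : 0 ≤ μ) :
    partFun d ε μ = partition (particleLaw d) (separated d ε) μ fun _ => 1 := by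
  have h := hasSum_partition (particleLaw d) (separated d ε) hμ (f := fun _ => 1) measurable_const
    zero_le_one (by simp)
  rw [← h.tsum_eq, partFun]
  refine tsum_congr fun N => ?_
  have hmp := measurePreserving_pi (fun _ : Fin N => particleLaw d) (fun _ => volume)
    fun _ => measurePreserving_fst_particleLaw
  have hex : MeasurableSet (excl d ε N) :=
    measurableSet_compatible (C := fun x y : Torus d => ε < dist x y)
      (measurableSet_lt measurable_const (measurable_fst.dist measurable_snd)) N
  have hv := hmp.measure_preimage hex.nullMeasurableSet
  simp [exclInt, compatible_separated, measureReal_def, hv, volume_pi]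

theorem gcMeasure_eq (ε : ℝ) {μ : ℝ} (hμ : 0 ≤ μ) :
    gcMeasure d ε μ =
      (ENNReal.ofReal (partition (particleLaw d) (separated d ε) μ fun _ => 1))⁻¹ •
        gas (particleLaw d) (separated d ε) μ := by
  simp only [gcMeasure, gas, partFun_eq_partition ε hμ, withDensity_sectorDens ε hμ]

theorem integral_gcMeasure (ε : ℝ) {μ : ℝ} (hμ : 0 ≤ μ) (F : Phase d → ℝ) :
    ∫ ω, F ω ∂(gcMeasure d ε μ) = (∫ ω, F ω ∂(gas (particleLaw d) (separated d ε) μ)) /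
      partition (particleLaw d) (separated d ε) μ fun _ => 1 := by
  have hZ : 1 ≤ partition (particleLaw d) (separated d ε) μ fun _ => 1 :=
    one_le_partition _ hμ ⟨measurable_const, by simp, by simp⟩
  rw [gcMeasure_eq ε hμ, integral_smul_measure, ENNReal.toReal_inv,
    ENNReal.toReal_ofReal (by linarith), smul_eq_mul, inv_mul_eq_div]

theorem integrable_sum_mul_sum (ε : ℝ) {μ : ℝ} (hμ : 0 ≤ μ) {a b : Torus d × Rd d → ℝ}
    (ha : Measurable a) (hb : Measurable b) {A B : ℝ} (hA0 : 0 ≤ A) (hB0 : 0 ≤ B)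
    (hA : ∀ x, |a x| ≤ A) (hB : ∀ x, |b x| ≤ B) :
    Integrable (fun ω => (∑ i, a (ω.2 i)) * ∑ i, b (ω.2 i))
      (gas (particleLaw d) (separated d ε) μ) := by
  refine integrable_gas _ _ hμ ((measurable_sum_config ha).mul (measurable_sum_config hb))
    (K := A * B) (R := 4) (by positivity) (by norm_num) fun ω => ?_
  rw [abs_mul, show (4 : ℝ) = 2 * 2 by norm_num, mul_pow, mul_mul_mul_comm]
  exact mul_le_mul (abs_sum_config_le hA0 hA ω) (abs_sum_config_le hB0 hB ω) (abs_nonneg _)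
    (by positivity)

theorem integral_fluct_mul_fluct (ε : ℝ) {μ : ℝ} (hμ : 0 < μ) {a b : Torus d × Rd d → ℝ}
    (ha : Measurable a) (hb : Measurable b) {A B : ℝ} (hA0 : 0 ≤ A) (hB0 : 0 ≤ B)
    (hA : ∀ x, |a x| ≤ A) (hB : ∀ x, |b x| ≤ B) :
    ∫ ω, fluct d ε μ a ω * fluct d ε μ b ω ∂(gcMeasure d ε μ) =
      μ⁻¹ * (∫ ω, (∑ i, a (ω.2 i)) * (∑ i, b (ω.2 i)) ∂(gcMeasure d ε μ)
        - (∫ ω, ∑ i, a (ω.2 i) ∂(gcMeasure d ε μ)) * ∫ ω, ∑ i, b (ω.2 i) ∂(gcMeasure d ε μ)) := by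
  set G := gcMeasure d ε μ with hG
  have hZ : 1 ≤ partition (particleLaw d) (separated d ε) μ fun _ => 1 :=
    one_le_partition _ hμ.le ⟨measurable_const, by simp, by simp⟩
  have hint : ∀ {F : Phase d → ℝ}, Integrable F (gas (particleLaw d) (separated d ε) μ) →
      Integrable F G := fun hF => by
    rw [hG, gcMeasure_eq ε hμ.le]
    exact hF.smul_measure (ENNReal.inv_ne_top.2 (ENNReal.ofReal_pos.2 (by linarith)).ne')
  have hone : ∫ _, (1 : ℝ) ∂G = 1 := by
    rw [hG, integral_gcMeasure ε hμ.le, div_eq_one_iff_eq (by linarith)]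
    simp [partition]
  have i1 := hint (integrable_sum_mul_sum ε hμ.le ha hb hA0 hB0 hA hB)
  have i2 := hint (integrable_gas (particleLaw d) (separated d ε) hμ.le (measurable_sum_config ha)
    hA0 zero_le_two (abs_sum_config_le hA0 hA))
  have i3 := hint (integrable_gas (particleLaw d) (separated d ε) hμ.le (measurable_sum_config hb)
    hB0 zero_le_two (abs_sum_config_le hB0 hB))
  have i4 : Integrable (fun _ => (1 : ℝ)) G :=
    hint (integrable_gas (particleLaw d) (separated d ε) hμ.le measurable_const
      zero_le_one zero_le_one (by simp))
  simp only [fluct, empir, ← hG, integral_const_mul]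
  set α := ∫ ω, ∑ i, a (ω.2 i) ∂G
  set β := ∫ ω, ∑ i, b (ω.2 i) ∂G
  have e : ∀ ω : Phase d, √μ * (μ⁻¹ * ∑ i, a (ω.2 i) - μ⁻¹ * α)
      * (√μ * (μ⁻¹ * ∑ i, b (ω.2 i) - μ⁻¹ * β))
      = μ⁻¹ * ((∑ i, a (ω.2 i)) * (∑ i, b (ω.2 i)) - β * ∑ i, a (ω.2 i)
        - α * ∑ i, b (ω.2 i) + α * β * 1) := fun ω => by
    have hs : √μ * √μ = μ := Real.mul_self_sqrt hμ.le
    have hc : √μ * √μ * μ⁻¹ = 1 := by rw [hs, mul_inv_cancel₀ hμ.ne']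
    linear_combination (μ⁻¹ * ((∑ i, a (ω.2 i)) - α) * ((∑ i, b (ω.2 i)) - β)) * hc
  simp only [e]
  have j1 : Integrable (fun ω : Phase d => (∑ i, a (ω.2 i)) * (∑ i, b (ω.2 i))
      - β * ∑ i, a (ω.2 i)) G := i1.sub (i2.const_mul β)
  have j2 : Integrable (fun ω : Phase d => (∑ i, a (ω.2 i)) * (∑ i, b (ω.2 i))
      - β * ∑ i, a (ω.2 i) - α * ∑ i, b (ω.2 i)) G := j1.sub (i3.const_mul α)
  rw [integral_const_mul, integral_add j2 (i4.const_mul _), integral_sub j1 (i3.const_mul α),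
    integral_sub i1 (i2.const_mul β), integral_const_mul, integral_const_mul, integral_const_mul,
    hone]
  ring

/-- Explicit rate in the convergence of the covariance of the fluctuation field. -/
theorem abs_integral_fluct_mul_fluct_sub_le {ε μ : ℝ} (hε : 0 ≤ ε) (hμ : 0 < μ)
    (hsmall : μ * (2 * ε) ^ d ≤ 1 / 4) {a b : Torus d × Rd d → ℝ}
    (ha : Measurable a) (hb : Measurable b) {A B : ℝ} (hA0 : 0 ≤ A) (hB0 : 0 ≤ B)
    (hA : ∀ x, |a x| ≤ A) (hB : ∀ x, |b x| ≤ B) :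
    |(∫ ω, fluct d ε μ a ω * fluct d ε μ b ω ∂(gcMeasure d ε μ))
      - ∫ z, a z * b z * Maxw d z.2| ≤ 6 * A * B * (μ * (2 * ε) ^ d) := by
  have h := abs_covariance_sub_le (particleLaw d) hμ.le (measurableSet_separated ε) separated_symm
    (fun y => mul_le_mul_of_nonneg_left (particleLaw_not_separated_le hε y) hμ.le)
    (by positivity) hsmall ha hb hA0 hB0 hA hB
  have hlaw : ∫ z, a z * b z ∂(particleLaw d) = ∫ z, a z * b z * Maxw d z.2 := by
    have hM : Measurable fun z : Torus d × Rd d => Maxw d z.2 :=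
      measurable_Maxw.comp measurable_snd
    rw [particleLaw, integral_withDensity_eq_integral_toReal_smul hM.ennreal_ofReal
      (Eventually.of_forall fun _ => ENNReal.ofReal_lt_top)]
    refine integral_congr_ae (Eventually.of_forall fun z => ?_)
    simp only [ENNReal.toReal_ofReal (Maxw_pos z.2).le, smul_eq_mul]
    ring
  rw [integral_fluct_mul_fluct ε hμ ha hb hA0 hB0 hA hB]
  simp only [integral_gcMeasure ε hμ.le, ← hlaw]
  refine le_of_mul_le_mul_left ?_ hμ
  rw [← abs_of_pos hμ, ← abs_mul, abs_of_pos hμ, mul_sub, ← mul_assoc μ μ⁻¹, mul_inv_cancel₀ hμ.ne',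
    one_mul]
  exact h.trans_eq (by ring)

end HardSphere

/-- convergence of the covariance of the fluctuation field: for bounded
Lipschitz `h₁, h₂`, `𝔼_{ε,μ_ε}[ζ(h₁) ζ(h₂)] → ∫ h₁ h₂ M dx dv` along any family
`μ_ε → ∞` with `μ_ε ε^d → 0`. -/
theorem fluct_covariance_limit (d : ℕ) (hd : 1 ≤ d)
    (h₁ h₂ : Torus d × Rd d → ℝ) (L₁ L₂ : NNReal)
    (hlip₁ : LipschitzWith L₁ h₁) (hlip₂ : LipschitzWith L₂ h₂)
    (hbdd₁ : ∃ B : ℝ, ∀ z, |h₁ z| ≤ B) (hbdd₂ : ∃ B : ℝ, ∀ z, |h₂ z| ≤ B)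
    (μ : ℝ → ℝ)
    (hμ : Tendsto μ (𝓝[>] (0 : ℝ)) atTop)
    (hμε : Tendsto (fun ε => μ ε * ε ^ d) (𝓝[>] (0 : ℝ)) (𝓝 0)) :
    Tendsto
      (fun ε => ∫ ω, fluct d ε (μ ε) h₁ ω * fluct d ε (μ ε) h₂ ω ∂(gcMeasure d ε (μ ε)))
      (𝓝[>] (0 : ℝ))
      (𝓝 (∫ z : Torus d × Rd d, h₁ z * h₂ z * Maxw d z.2)) := by
  obtain ⟨A, hA⟩ := hbdd₁
  obtain ⟨B, hB⟩ := hbdd₂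
  have hA0 : 0 ≤ A := (abs_nonneg _).trans (hA 0)
  have hB0 : 0 ≤ B := (abs_nonneg _).trans (hB 0)
  have hκ : Tendsto (fun ε => μ ε * (2 * ε) ^ d) (𝓝[>] (0 : ℝ)) (𝓝 0) := by
    have := hμε.const_mul (2 ^ d)
    rw [mul_zero] at this
    exact this.congr fun ε => by rw [mul_pow]; ring
  rw [tendsto_iff_norm_sub_tendsto_zero]
  have hbound := hκ.const_mul (6 * A * B)
  rw [mul_zero] at hbound
  refine squeeze_zero' (Eventually.of_forall fun _ => norm_nonneg _) ?_ hbound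
  filter_upwards [self_mem_nhdsWithin, hμ.eventually_gt_atTop 0,
    hκ.eventually_le_const (show (0 : ℝ) < 1 / 4 by norm_num)] with ε hε hpos hsmall
  exact HardSphere.abs_integral_fluct_mul_fluct_sub_le (le_of_lt hε) hpos hsmall
    hlip₁.continuous.measurable hlip₂.continuous.measurable hA0 hB0 hA hB

end
end
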